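/- arXiv:math/9908074 — 5 statements merged into one kernel-verified Lean document; each statement's English description precedes it below -/
import Mathlib

section
/- If X is a normal countably compact topological space and L is a simplicial complex (with the metric topology), then L is an absolute neighborhood extensor of X: every continuous map from a closed subset Y of X into L extends to a continuous map from some open neighborhood of Y in X into L. -/
open Set Topology

universe u v w

/-- An abstract simplicial complex on a vertex set `V`. -/
structure SimpComplex (V : Type v) where
  faces : Set (Finset V)
  down_closed : ∀ s ∈ faces, ∀ t, t ⊆ s → t.Nonempty → t ∈ faces

/-- The geometric realization of a simplicial complex with the metric (ℓ¹) topology,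
realized inside the Banach space `ℓ¹(V)`. -/
def SimpComplex.space {V : Type v} (K : SimpComplex V) : Set (lp (fun _ : V => ℝ) 1) :=
  {f | ∃ s ∈ K.faces, (∀ v : V, (f : ∀ _ : V, ℝ) v ≠ 0 → v ∈ s) ∧
    (∀ v : V, 0 ≤ (f : ∀ _ : V, ℝ) v) ∧ ∑ v ∈ s, (f : ∀ _ : V, ℝ) v = 1}

/-- `Z` is an absolute extensor of `X`: every continuous map from a closed subset of `X`
into `Z` extends continuously over all of `X`. -/
def IsAE (Z X : Type*) [TopologicalSpace Z] [TopologicalSpace X] : Prop :=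
  ∀ Y : Set X, IsClosed Y → ∀ f : C(Y, Z), ∃ g : C(X, Z), ∀ y : Y, g y = f y

/-- `Z` is an absolute neighborhood extensor of `X`. -/
def IsANE (Z X : Type*) [TopologicalSpace Z] [TopologicalSpace X] : Prop :=
  ∀ Y : Set X, IsClosed Y → ∀ f : C(Y, Z),
    ∃ U : Set X, IsOpen U ∧ Y ⊆ U ∧ ∃ g : C(U, Z),
      ∀ (y : Y) (h : (y : X) ∈ U), g ⟨y, h⟩ = f y

/-- A space is countably compact if every countable open cover has a finite subcover. -/
def CountablyCompact (X : Type*) [TopologicalSpace X] : Prop :=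
  ∀ 𝒰 : ℕ → Set X, (∀ n, IsOpen (𝒰 n)) → (⋃ n, 𝒰 n) = univ →
    ∃ t : Finset ℕ, (⋃ n ∈ t, 𝒰 n) = univ

/-- A set is functionally open if it is the cozero set of a real-valued continuous function. -/
def FunctionallyOpen {X : Type*} [TopologicalSpace X] (U : Set X) : Prop :=
  ∃ φ : C(X, ℝ), U = φ ⁻¹' ({0}ᶜ)

/-- `CovDimLE X n` : every finite functionally open cover of `X` has a finite functionally
open refinement of order at most `n + 1` (any `n + 2` distinct members meet emptily). -/
def CovDimLE (X : Type*) [TopologicalSpace X] (n : ℕ) : Prop :=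
  ∀ 𝒰 : Finset (Set X), (∀ U ∈ 𝒰, FunctionallyOpen U) → ⋃₀ (𝒰 : Set (Set X)) = univ →
    ∃ 𝒱 : Finset (Set X), (∀ V ∈ 𝒱, FunctionallyOpen V) ∧ ⋃₀ (𝒱 : Set (Set X)) = univ ∧
      (∀ V ∈ 𝒱, ∃ U ∈ 𝒰, V ⊆ U) ∧
      ∀ 𝒲 : Finset (Set X), 𝒲 ⊆ 𝒱 → n + 1 < 𝒲.card → ⋂₀ (𝒲 : Set (Set X)) = ∅

/-- The covering dimension of `X` as an extended natural number (`⊤` if no finite bound). -/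
noncomputable def covDim (X : Type*) [TopologicalSpace X] : ℕ∞ :=
  sInf ((↑) '' {n : ℕ | CovDimLE X n})

/-- The Stone–Čech remainder `βX \ X`. -/
def StoneCechRemainder (X : Type*) [TopologicalSpace X] : Set (StoneCech X) :=
  (range (stoneCechUnit : X → StoneCech X))ᶜ

/-- The space `ℓ¹(V)`. -/
abbrev EllOne (V : Type v) : Type v := lp (fun _ : V => ℝ) 1

theorem ellOne_summable {V : Type v} (f : EllOne V) : Summable fun v => |f v| := by
  have := (lp.memℓp f).summable (by simp)
  simpa using this

theorem ellOne_norm {V : Type v} (f : EllOne V) : ‖f‖ = ∑' v, |f v| := by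
  have := lp.norm_eq_tsum_rpow (p := 1) (by simp) f
  simpa using this

theorem ellOne_abs_le {V : Type v} (f : EllOne V) (v : V) : |f v| ≤ ‖f‖ := by
  have := lp.norm_apply_le_norm (p := 1) (by simp) f v
  simpa using this

/-- The soft threshold operation on `ℓ¹(V)`. -/
noncomputable def softT {V : Type v} (f : EllOne V) (t : ℝ) : EllOne V :=
  ⟨fun v => max (f v - |t|) 0, by
    refine memℓp_gen ?_
    simp only [ENNReal.toReal_one, Real.rpow_one, Real.norm_eq_abs]
    refine Summable.of_nonneg_of_le (fun v => abs_nonneg _) (fun v => ?_) (ellOne_summable f)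
    grind⟩

theorem softT_apply {V : Type v} (f : EllOne V) (t : ℝ) (v : V) :
    softT f t v = max (f v - |t|) 0 := rfl

theorem softT_lip {V : Type v} (f g : EllOne V) (t : ℝ) :
    ‖softT f t - softT g t‖ ≤ ‖f - g‖ := by
  rw [ellOne_norm, ellOne_norm]
  refine (ellOne_summable _).tsum_le_tsum (fun v => ?_) (ellOne_summable _)
  simp only [lp.coeFn_sub, Pi.sub_apply, softT_apply]
  grind

theorem softT_cont_right {V : Type v} (f : EllOne V) : Continuous (softT f) := by
  rw [continuous_iff_continuousAt]
  intro t
  rw [ContinuousAt, tendsto_iff_norm_sub_tendsto_zero]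
  simp only [ellOne_norm, lp.coeFn_sub, Pi.sub_apply, softT_apply]
  have := tendsto_tsum_of_dominated_convergence (𝓕 := 𝓝 t) (bound := fun v => |f v|)
    (f := fun s v => |max (f v - |s|) 0 - max (f v - |t|) 0|) (g := fun v => (0 : ℝ))
    (ellOne_summable f) ?_ ?_
  · simpa using this
  · intro v
    have hc : Continuous fun s : ℝ => |max (f v - |s|) 0 - max (f v - |t|) 0| := by fun_prop
    simpa using hc.tendsto t
  · refine Filter.Eventually.of_forall fun s v => ?_
    rw [Real.norm_eq_abs, abs_abs]
    grind

theorem softT_continuous {V : Type v} {X : Type u} [TopologicalSpace X] {F : X → EllOne V}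
    {t : X → ℝ} (hF : Continuous F) (ht : Continuous t) :
    Continuous fun x => softT (F x) (t x) := by
  rw [continuous_iff_continuousAt]
  intro x
  rw [ContinuousAt, tendsto_iff_norm_sub_tendsto_zero]
  have h1 : Filter.Tendsto (fun y => ‖F y - F x‖ + ‖softT (F x) (t y) - softT (F x) (t x)‖)
      (𝓝 x) (𝓝 0) := by
    have hc : Continuous (fun y => ‖F y - F x‖ + ‖softT (F x) (t y) - softT (F x) (t x)‖) :=
      (hF.sub continuous_const).norm.add
        ((((softT_cont_right (F x)).comp ht)).sub continuous_const).norm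
    simpa using hc.tendsto x
  refine squeeze_zero (fun _ => norm_nonneg _) (fun y => ?_) h1
  calc _ ≤ ‖softT (F y) (t y) - softT (F x) (t y)‖ + ‖softT (F x) (t y) - softT (F x) (t x)‖ :=
        norm_sub_le_norm_sub_add_norm_sub _ _ _
    _ ≤ _ := by gcongr; exact softT_lip _ _ _

open BoundedContinuousFunction in
/-- Bounded maps which have values in a fixed finite-dimensional coordinate subspace. -/
def finSub (Y : Type u) [TopologicalSpace Y] (V : Type v) : AddSubgroup (Y →ᵇ EllOne V) where
  carrier := {g | ∃ S : Finset V, ∀ y, ∀ v ∉ S, g y v = 0}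
  zero_mem' := ⟨∅, fun y v _ => by simp⟩
  add_mem' := by
    classical
    rintro a b ⟨S, hS⟩ ⟨T, hT⟩
    refine ⟨S ∪ T, fun y v hv => ?_⟩
    rw [Finset.mem_union, not_or] at hv
    simp [hS y v hv.1, hT y v hv.2]
  neg_mem' := by
    rintro a ⟨S, hS⟩
    exact ⟨S, fun y v hv => by simp [hS y v hv]⟩

open BoundedContinuousFunction in
/-- Restriction of bounded continuous maps to a subset. -/
noncomputable def restrHom {X : Type u} [TopologicalSpace X] (Y : Set X) (V : Type v) :
    NormedAddGroupHom (X →ᵇ EllOne V) (Y →ᵇ EllOne V) :=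
  AddMonoidHom.mkNormedAddGroupHom
    { toFun := fun g => g.compContinuous ⟨Subtype.val, continuous_subtype_val⟩
      map_zero' := by ext; simp
      map_add' := fun a b => by ext; simp } 1 (fun g => by
        rw [one_mul]
        exact (BoundedContinuousFunction.norm_le (norm_nonneg _)).2
          fun y => g.norm_coe_le_norm _)

open BoundedContinuousFunction in
theorem restrHom_apply {X : Type u} [TopologicalSpace X] (Y : Set X) (V : Type v)
    (g : X →ᵇ EllOne V) (y : Y) : restrHom Y V g y = g y := rfl

open BoundedContinuousFunction in
theorem restrHom_surj {X : Type u} [TopologicalSpace X] [NormalSpace X] {Y : Set X}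
    (hY : IsClosed Y) (V : Type v) : (restrHom Y V).SurjectiveOnWith (finSub Y V) 1 := by
  classical
  rintro h ⟨S, hS⟩
  by_cases hM : ‖h‖ = 0
  · refine ⟨0, ?_, by simp⟩
    rw [norm_eq_zero.1 hM, map_zero]
  have hM0 : 0 < ‖h‖ := lt_of_le_of_ne (norm_nonneg _) (Ne.symm hM)
  have hcoord : ∀ v, Continuous fun y : Y => h y v := fun v => by
    have : LipschitzWith 1 (fun f : EllOne V => f v) := LipschitzWith.of_dist_le_mul fun f g => by
      simpa [dist_eq_norm] using ellOne_abs_le (f - g) v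
    exact this.continuous.comp h.continuous
  have hext : ∀ v, ∃ g : C(X, ℝ), ∀ y : Y, g y = h y v := fun v => by
    obtain ⟨g, hg⟩ := ContinuousMap.exists_restrict_eq hY ⟨fun y : Y => h y v, hcoord v⟩
    exact ⟨g, fun y => DFunLike.congr_fun hg y⟩
  choose g hg using hext
  let G : X → EllOne V := fun x => ∑ v ∈ S, lp.single 1 v (g v x)
  have hGc : Continuous G := by
    refine continuous_finsetSum _ fun v _ => ?_
    exact (lp.singleContinuousLinearMap ℝ (fun _ : V => ℝ) 1 v).continuous.comp (g v).continuous
  have hGY : ∀ y : Y, G y = h y := fun y => by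
    ext v
    simp only [G, lp.coeFn_sum, Finset.sum_apply, lp.coeFn_single, hg, Finset.sum_pi_single]
    split_ifs with hv
    · rfl
    · exact (hS y v hv).symm
  have hpos : ∀ x, 0 < max ‖h‖ ‖G x‖ := fun x => lt_max_of_lt_left hM0
  let G' : X → EllOne V := fun x => (‖h‖ / max ‖h‖ ‖G x‖) • G x
  have hG'c : Continuous G' :=
    (continuous_const.div (continuous_const.max hGc.norm) fun x => (hpos x).ne').smul hGc
  have hG'b : ∀ x, ‖G' x‖ ≤ ‖h‖ := fun x => by
    simp only [G', norm_smul, norm_div, Real.norm_eq_abs, abs_norm, abs_of_pos (hpos x)]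
    rw [div_mul_eq_mul_div, div_le_iff₀ (hpos x)]
    gcongr
    exact le_max_right _ _
  refine ⟨BoundedContinuousFunction.ofNormedAddCommGroup G' hG'c ‖h‖ hG'b, ?_, ?_⟩
  · ext1 y
    rw [restrHom_apply]
    change G' y = h y
    simp only [G', hGY, max_eq_left (h.norm_coe_le_norm y), div_self hM, one_smul]
  · rw [one_mul]
    exact (BoundedContinuousFunction.norm_le (norm_nonneg _)).2 hG'b

theorem ellOne_compl_le {V : Type v} [DecidableEq V] (f : EllOne V) (S : Finset V) :
    ‖f - ∑ i ∈ S, lp.single 1 i (f i)‖ ≤ ‖f‖ := by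
  have := lp.norm_compl_sum_single (p := 1) (by simp) f S
  simp only [ENNReal.toReal_one, Real.rpow_one] at this
  rw [this]
  have : 0 ≤ ∑ i ∈ S, ‖f i‖ := Finset.sum_nonneg fun _ _ => norm_nonneg _
  linarith

theorem ellOne_compl_mono {V : Type v} [DecidableEq V] (f : EllOne V) {S T : Finset V}
    (h : S ⊆ T) :
    ‖f - ∑ i ∈ T, lp.single 1 i (f i)‖ ≤ ‖f - ∑ i ∈ S, lp.single 1 i (f i)‖ := by
  have h1 := lp.norm_compl_sum_single (p := 1) (by simp) f S
  have h2 := lp.norm_compl_sum_single (p := 1) (by simp) f T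
  simp only [ENNReal.toReal_one, Real.rpow_one] at h1 h2
  rw [h1, h2]
  have : ∑ i ∈ S, ‖f i‖ ≤ ∑ i ∈ T, ‖f i‖ :=
    Finset.sum_le_sum_of_subset_of_nonneg h fun _ _ _ => norm_nonneg _
  linarith

/-- Compact subsets of `ℓ¹` have uniformly small tails. -/
theorem ellOne_tail {V : Type v} [DecidableEq V] {K : Set (EllOne V)} (hK : IsCompact K) {ε : ℝ}
    (hε : 0 < ε) : ∃ S : Finset V, ∀ f ∈ K, ‖f - ∑ i ∈ S, lp.single 1 i (f i)‖ < ε := by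
  refine hK.elim_directed_cover
    (fun S : Finset V => {f : EllOne V | ‖f - ∑ i ∈ S, lp.single 1 i (f i)‖ < ε}) ?_ ?_ ?_
  · intro S
    refine isOpen_lt ?_ continuous_const
    have : LipschitzWith 1 (fun f : EllOne V => f - ∑ i ∈ S, lp.single 1 i (f i)) :=
      LipschitzWith.of_dist_le_mul fun f g => by
        have := ellOne_compl_le (f - g) S
        rw [dist_eq_norm, dist_eq_norm, NNReal.coe_one, one_mul]
        have he : f - ∑ i ∈ S, lp.single 1 i (f i) - (g - ∑ i ∈ S, lp.single 1 i (g i)) =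
            (f - g) - ∑ i ∈ S, lp.single 1 i ((f - g) i) := by
          simp only [lp.coeFn_sub, Pi.sub_apply, lp.single_sub, Finset.sum_sub_distrib]
          abel
        rw [he]
        exact this
    exact this.continuous.norm
  · intro f _
    have := lp.hasSum_single (p := 1) (by simp) f
    have h2 := (tendsto_iff_norm_sub_tendsto_zero.1 this).eventually_lt_const hε
    obtain ⟨S, hS⟩ := h2.exists
    refine mem_iUnion.2 ⟨S, ?_⟩
    rw [norm_sub_rev] at hS
    exact hS
  · intro S T
    exact ⟨S ∪ T, fun f hf => (ellOne_compl_mono f Finset.subset_union_left).trans_lt hf,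
      fun f hf => (ellOne_compl_mono f Finset.subset_union_right).trans_lt hf⟩

/-- Tietze extension for maps to `ℓ¹` with compact image. -/
theorem ellOne_tietze {X : Type u} [TopologicalSpace X] [NormalSpace X] {Y : Set X}
    (hY : IsClosed Y) {V : Type v} (f : C(Y, EllOne V)) (hK : IsCompact (range f)) :
    ∃ F : C(X, EllOne V), ∀ y : Y, F y = f y := by
  classical
  obtain ⟨C, hC⟩ := hK.isBounded.exists_norm_le
  let fb := BoundedContinuousFunction.ofNormedAddCommGroup f f.continuous C
    (fun y => hC _ (mem_range_self y))
  have hcl : fb ∈ (finSub Y V).topologicalClosure := by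
    change fb ∈ closure (finSub Y V : Set _)
    rw [Metric.mem_closure_iff]
    intro ε hε
    obtain ⟨S, hS⟩ := ellOne_tail hK (half_pos hε)
    have hcoord : ∀ v, Continuous fun y : Y => f y v := fun v => by
      have : LipschitzWith 1 (fun f : EllOne V => f v) :=
        LipschitzWith.of_dist_le_mul fun f g => by
          simpa [dist_eq_norm] using ellOne_abs_le (f - g) v
      exact this.continuous.comp f.continuous
    let g : Y → EllOne V := fun y => ∑ i ∈ S, lp.single 1 i (f y i)
    have hgc : Continuous g := by
      refine continuous_finsetSum _ fun v _ => ?_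
      exact (lp.singleContinuousLinearMap ℝ (fun _ : V => ℝ) 1 v).continuous.comp (hcoord v)
    have hgb : ∀ y, ‖g y‖ ≤ C + ε / 2 := fun y => by
      have h1 := hS _ (mem_range_self y)
      have h2 := hC _ (mem_range_self y)
      have h3 := norm_sub_norm_le (g y) (f y)
      rw [norm_sub_rev] at h3
      change ‖f y - g y‖ < _ at h1
      linarith
    refine ⟨BoundedContinuousFunction.ofNormedAddCommGroup g hgc _ hgb, ⟨S, fun y v hv => ?_⟩, ?_⟩
    · change g y v = 0
      simp only [g, lp.coeFn_sum, Finset.sum_apply, lp.coeFn_single, Finset.sum_pi_single]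
      simp [hv]
    · refine lt_of_le_of_lt ((BoundedContinuousFunction.dist_le (half_pos hε).le).2 fun y => ?_)
        (half_lt_self hε)
      rw [dist_eq_norm]
      exact (hS _ (mem_range_self y)).le
  obtain ⟨F, hF, -⟩ := controlled_closure_of_complete one_pos one_pos (restrHom_surj hY V) fb hcl
  exact ⟨F.toContinuousMap, fun y => DFunLike.congr_fun hF y⟩

theorem countablyCompact_range {X : Type u} [TopologicalSpace X] (hX : CountablyCompact X)
    {Y : Set X} (hY : IsClosed Y) {E : Type v} [MetricSpace E] (f : C(Y, E)) :
    IsCompact (range f) := by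
  have h0 : IsCountablyCompact (univ : Set X) := by
    rw [isCountablyCompact_iff_countable_open_cover]
    intro U hU hc
    obtain ⟨t, ht⟩ := hX U hU (univ_subset_iff.1 hc)
    exact ⟨t, ht.ge⟩
  have h1 : IsCountablyCompact Y := h0.of_isClosed_subset hY (subset_univ _)
  rw [isCountablyCompact_iff_isCountablyCompact_univ] at h1
  have h2 := h1.image f.continuous
  rw [image_univ] at h2
  exact _root_.isCompact_iff_isSeqCompact.2 h2.isSeqCompact

/-- A simplicial complex (with the metric topology) is an absolute neighborhood extensor
of every normal countably compact space. -/
theorem simpComplex_isANE (X : Type u) [TopologicalSpace X] [NormalSpace X]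
    (hX : CountablyCompact X) {V : Type v} (L : SimpComplex V) :
    IsANE ↥L.space X := by
  intro Y hY f
  rcases isEmpty_or_nonempty Y with hYe | hYn
  · refine ⟨∅, isOpen_empty, fun y hy => (hYe.false ⟨y, hy⟩).elim,
      ⟨fun x => x.2.elim, continuous_of_const fun x => x.2.elim⟩, fun y => (hYe.false y).elim⟩
  let f' : C(Y, EllOne V) := ⟨fun y => (f y : EllOne V), continuous_subtype_val.comp f.continuous⟩
  have hK : IsCompact (range f') := countablyCompact_range hX hY f'
  have hKn : (range f').Nonempty := range_nonempty _
  obtain ⟨F, hF⟩ := ellOne_tietze hY f' hK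
  let P : X → EllOne V := fun x => softT (F x) (Metric.infDist (F x) (range f'))
  have hPc : Continuous P :=
    softT_continuous F.continuous ((Metric.continuous_infDist_pt _).comp F.continuous)
  have hP0 : ∀ x v, 0 ≤ P x v := fun x v => le_max_right _ _
  have hP : ∀ x, ∃ s ∈ L.faces, ∀ v, P x v ≠ 0 → v ∈ s := fun x => by
    obtain ⟨z, ⟨y, rfl⟩, hz⟩ := hK.exists_infDist_eq_dist hKn (F x)
    obtain ⟨s, hs, hsupp, -, -⟩ := (f y).2
    refine ⟨s, hs, fun v hv => ?_⟩
    by_contra hvs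
    apply hv
    have hzv : f' y v = 0 := by
      by_contra h
      exact hvs (hsupp v h)
    have h1 := ellOne_abs_le (F x - f' y) v
    rw [← dist_eq_norm, ← hz, lp.coeFn_sub, Pi.sub_apply, hzv, sub_zero] at h1
    have h2 := (le_abs_self (F x v)).trans (h1.trans (le_abs_self _))
    change max _ _ = _
    exact max_eq_right (by linarith)
  have hnorm : ∀ (w : EllOne V) (s : Finset V), (∀ v, 0 ≤ w v) → (∀ v, w v ≠ 0 → v ∈ s) →
      ‖w‖ = ∑ v ∈ s, w v := fun w s h0 hs => by
    rw [ellOne_norm, tsum_eq_sum (s := s)]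
    · exact Finset.sum_congr rfl fun v _ => abs_of_nonneg (h0 v)
    · intro v hv
      rw [abs_eq_zero]
      by_contra h
      exact hv (hs v h)
  have hPY : ∀ y : Y, P y = f' y := fun y => by
    obtain ⟨s, hs, hsupp, hpos, -⟩ := (f y).2
    ext v
    change max (F y v - |Metric.infDist (F y) (range f')|) 0 = _
    rw [hF, Metric.infDist_zero_of_mem (mem_range_self y), abs_zero, sub_zero]
    exact max_eq_left (hpos v)
  have hfn : ∀ y : Y, ‖f' y‖ = 1 := fun y => by
    obtain ⟨s, hs, hsupp, hpos, hsum⟩ := (f y).2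
    rw [hnorm (f' y) s hpos hsupp]
    exact hsum
  let U : Set X := {x | 0 < ‖P x‖}
  have hmem : ∀ x : U, ‖P x‖⁻¹ • P x ∈ L.space := fun x => by
    obtain ⟨s, hs, hsupp⟩ := hP x
    have hx : 0 < ‖P x‖ := x.2
    refine ⟨s, hs, fun v hv => hsupp v fun h => hv (by simp [h]), fun v => ?_, ?_⟩
    · simp only [lp.coeFn_smul, Pi.smul_apply, smul_eq_mul]
      exact mul_nonneg (inv_nonneg.2 hx.le) (hP0 x v)
    · simp only [lp.coeFn_smul, Pi.smul_apply, smul_eq_mul]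
      rw [← Finset.mul_sum, ← hnorm (P x) s (hP0 x) hsupp, inv_mul_cancel₀ hx.ne']
  refine ⟨U, isOpen_lt continuous_const hPc.norm, fun y hy => ?_,
    ⟨fun x => ⟨‖P x‖⁻¹ • P x, hmem x⟩, ?_⟩, fun y h => ?_⟩
  · change 0 < ‖P y‖
    rw [hPY ⟨y, hy⟩, hfn]
    exact one_pos
  · have hc := hPc.comp (continuous_subtype_val (p := fun x => x ∈ U))
    exact ((hc.norm.inv₀ fun x => (show 0 < ‖P x‖ from x.2).ne').smul hc).subtype_mk _
  · apply Subtype.ext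
    change ‖P y‖⁻¹ • P y = f' y
    rw [hPY, hfn, inv_one, one_smul]
end

section
/- Let X be a countably compact normal (Tychonoff) space and L a simplicial complex with the metric topology. Then L is an absolute extensor of X if and only if L is an absolute extensor of the Stone–Čech compactification βX. -/
open Set Topology

universe u v w

section AEproof
open Filter

abbrev E1 (V : Type v) := lp (fun _ : V => ℝ) 1

lemma E1.summable {V : Type v} (x : E1 V) : Summable fun i => |x i| := by
  simpa using (lp.memℓp x).summable (by simp)

lemma E1.norm_eq {V : Type v} (x : E1 V) : ‖x‖ = ∑' i, |x i| := by
  simpa using lp.norm_eq_tsum_rpow (p := 1) (by simp) x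

lemma E1.abs_le {V : Type v} (x : E1 V) (i : V) : |x i| ≤ ‖x‖ := by
  simpa using lp.norm_apply_le_norm (p := 1) (by simp) x i

lemma cut_le (a c : ℝ) (hc : 0 ≤ c) : |max (a - c) 0| ≤ |a| := by
  rw [abs_of_nonneg (le_max_right _ _)]
  exact max_le (by linarith [le_abs_self a]) (abs_nonneg a)

/-- Truncation: `x ↦ (x - |c|)⁺`. -/
noncomputable def cut {V : Type v} (x : E1 V) (c : ℝ) : E1 V :=
  ⟨fun i => max (x i - |c|) 0, memℓp_gen (by
    simpa using Summable.of_nonneg_of_le (fun i => abs_nonneg _)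
      (fun i => cut_le (x i) |c| (abs_nonneg c)) (E1.summable x))⟩

@[simp] lemma cut_apply {V : Type v} (x : E1 V) (c : ℝ) (i : V) :
    cut x c i = max (x i - |c|) 0 := rfl

lemma cut_lip {V : Type v} (x y : E1 V) (c : ℝ) : ‖cut x c - cut y c‖ ≤ ‖x - y‖ := by
  rw [E1.norm_eq, E1.norm_eq]
  refine Summable.tsum_le_tsum (fun i => ?_) (E1.summable _) (E1.summable _)
  simp only [lp.coeFn_sub, Pi.sub_apply, cut_apply]
  refine (abs_max_sub_max_le_abs _ _ _).trans (le_of_eq ?_)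
  congr 1; ring

lemma cut_cont_c {V : Type v} (x : E1 V) : Continuous fun c => cut x c := by
  rw [continuous_iff_continuousAt]
  intro c
  rw [ContinuousAt, tendsto_iff_norm_sub_tendsto_zero]
  simp only [E1.norm_eq]
  have : (0:ℝ) = ∑' i : V, (0:ℝ) := by simp
  rw [this]
  refine tendsto_tsum_of_dominated_convergence (bound := fun i => 2 * |x i|)
    ((E1.summable x).mul_left 2) (fun i => ?_) (Eventually.of_forall fun d i => ?_)
  · have h : Continuous fun d : ℝ => |(cut x d - cut x c) i| := by
      simp only [lp.coeFn_sub, Pi.sub_apply, cut_apply]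
      fun_prop
    have := h.tendsto c
    simpa using this
  · simp only [lp.coeFn_sub, Pi.sub_apply, Real.norm_eq_abs, abs_abs]
    refine (abs_sub _ _).trans ?_
    have h1 := cut_le (x i) |c| (abs_nonneg c)
    have h2 := cut_le (x i) |d| (abs_nonneg d)
    simp only [cut_apply]
    linarith

lemma cut_cont {V : Type v} : Continuous fun p : E1 V × ℝ => cut p.1 p.2 := by
  rw [continuous_iff_continuousAt]
  rintro ⟨x, c⟩
  rw [ContinuousAt, tendsto_iff_norm_sub_tendsto_zero]
  refine squeeze_zero (fun _ => norm_nonneg _)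
    (g := fun p : E1 V × ℝ => ‖p.1 - x‖ + ‖cut x p.2 - cut x c‖) (fun p => ?_) ?_
  · have := cut_lip p.1 x p.2
    have h2 := norm_add_le (cut p.1 p.2 - cut x p.2) (cut x p.2 - cut x c)
    simp only [sub_add_sub_cancel] at h2
    linarith
  · have h : Continuous fun p : E1 V × ℝ => ‖p.1 - x‖ + ‖cut x p.2 - cut x c‖ := by
      have := (cut_cont_c x).comp (continuous_snd (X := E1 V) (Y := ℝ))
      simp only [Function.comp_def] at this
      fun_prop
    simpa using h.tendsto (x, c)

/-- Approximate Tietze step for Banach-space valued maps. -/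
lemma tietze_step {K : Type u} [TopologicalSpace K] [CompactSpace K] [T2Space K] {Y : Set K}
    (hY : IsClosed Y) {E : Type w} [NormedAddCommGroup E] [NormedSpace ℝ E] (f : C(Y, E))
    (M : ℝ) (hM : 0 < M) (hf : ∀ y, ‖f y‖ ≤ M) :
    ∃ g : C(K, E), (∀ x, ‖g x‖ ≤ M) ∧ ∀ y : Y, ‖f y - g y‖ ≤ M / 2 := by
  have := exists_continuous_forall_mem_convex_of_local_const (X := K) (E := E)
    (t := fun x => Metric.closedBall 0 M ∩ ⋂ h : x ∈ Y, Metric.closedBall (f ⟨x, h⟩) (M / 2))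
    (fun x => (convex_closedBall _ _).inter (convex_iInter fun h => convex_closedBall _ _))
    (fun x => ?_)
  · obtain ⟨g, hg⟩ := this
    refine ⟨g, fun x => by simpa using (hg x).1, fun y => ?_⟩
    have := mem_iInter.1 (hg y).2 y.2
    rw [mem_closedBall_iff_norm'] at this
    exact this
  · by_cases hx : x ∈ Y
    · refine ⟨f ⟨x, hx⟩, ?_⟩
      have h1 : ∀ᶠ y : Y in 𝓝 ⟨x, hx⟩, dist (f y) (f ⟨x, hx⟩) < M / 2 :=
        Metric.tendsto_nhds.1 (f.continuous.tendsto ⟨x, hx⟩) _ (by positivity)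
      rw [nhds_subtype_eq_comap, eventually_comap] at h1
      filter_upwards [h1] with y hy
      refine ⟨by simpa using hf _, mem_iInter.2 fun h => ?_⟩
      have := hy ⟨y, h⟩ rfl
      rw [Metric.mem_closedBall, dist_comm]
      exact this.le
    · refine ⟨0, ?_⟩
      filter_upwards [hY.isOpen_compl.mem_nhds hx] with y hy
      exact ⟨by simpa using hM.le, mem_iInter.2 fun h => (hy h).elim⟩

/-- Tietze extension for Banach-space valued maps on compact Hausdorff spaces. -/
lemma tietze_banach {K : Type u} [TopologicalSpace K] [CompactSpace K] [T2Space K] {Y : Set K}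
    (hY : IsClosed Y) {E : Type w} [NormedAddCommGroup E] [NormedSpace ℝ E] [CompleteSpace E]
    (f : C(Y, E)) : ∃ g : C(K, E), ∀ y : Y, g y = f y := by
  have : CompactSpace Y := isCompact_iff_compactSpace.1 hY.isCompact
  have H : ∀ (n : ℕ) (h : C(Y, E)), ∃ g : C(K, E), (∀ y, ‖h y‖ ≤ (‖f‖ + 1) / 2 ^ n) →
      (∀ x, ‖g x‖ ≤ (‖f‖ + 1) / 2 ^ n) ∧ ∀ y : Y, ‖h y - g y‖ ≤ (‖f‖ + 1) / 2 ^ n / 2 := by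
    intro n h
    by_cases hh : ∀ y, ‖h y‖ ≤ (‖f‖ + 1) / 2 ^ n
    · obtain ⟨g, hg⟩ := tietze_step hY h ((‖f‖ + 1) / 2 ^ n) (by positivity) hh
      exact ⟨g, fun _ => hg⟩
    · exact ⟨0, fun h => (hh h).elim⟩
  choose G hG using H
  let F : ℕ → C(Y, E) := fun n => Nat.rec f (fun n h => h - (G n h).restrict Y) n
  have F0 : F 0 = f := rfl
  have FS : ∀ n, F (n + 1) = F n - (G n (F n)).restrict Y := fun n => rfl
  have hF : ∀ n, ∀ y, ‖F n y‖ ≤ (‖f‖ + 1) / 2 ^ n := by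
    intro n
    induction n with
    | zero => intro y; rw [F0]; have := f.norm_coe_le_norm y; simp; linarith
    | succ n ih =>
      intro y
      have := (hG n (F n) ih).2 y
      rw [FS, pow_succ, ← div_div]
      exact this
  have hgn : ∀ n, ‖G n (F n)‖ ≤ (‖f‖ + 1) / 2 ^ n := fun n =>
    (ContinuousMap.norm_le _ (by positivity)).2 (hG n (F n) (hF n)).1
  have hlim : Tendsto (fun n : ℕ => (‖f‖ + 1) / 2 ^ n) atTop (𝓝 0) := by
    have := (tendsto_pow_atTop_nhds_zero_of_lt_one (r := (1/2 : ℝ)) (by norm_num)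
      (by norm_num)).const_mul (‖f‖ + 1)
    simpa [div_eq_mul_inv] using this
  have hsum : Summable fun n => G n (F n) := by
    refine Summable.of_norm_bounded (g := fun n : ℕ => (‖f‖ + 1) * (1 / 2) ^ n)
      ((summable_geometric_of_lt_one (by norm_num) (by norm_num)).mul_left _) fun n => ?_
    have := hgn n
    simpa [div_eq_mul_inv] using this
  refine ⟨∑' n, G n (F n), fun y => ?_⟩
  have h1 := (ContinuousMap.hasSum_apply hsum.hasSum (y : K)).tendsto_sum_nat
  refine tendsto_nhds_unique h1 ?_
  have h2 : ∀ n, ∑ i ∈ Finset.range n, G i (F i) y = f y - F n y := by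
    intro n
    induction n with
    | zero => simp [F0]
    | succ n ih => rw [Finset.sum_range_succ, ih, FS]; simp; abel
  simp_rw [h2]
  have h3 : Tendsto (fun n => F n y) atTop (𝓝 0) :=
    squeeze_zero_norm (fun n => hF n y) hlim
  simpa using h3.const_sub (f y)

lemma cut_mem {V : Type v} (L : SimpComplex V) {C : Set (E1 V)} (hC : IsCompact C)
    (hCL : C ⊆ L.space) (hne : C.Nonempty) (x : E1 V) (hx : cut x (Metric.infDist x C) ≠ 0) :
    ‖cut x (Metric.infDist x C)‖⁻¹ • cut x (Metric.infDist x C) ∈ L.space := by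
  classical
  obtain ⟨c, hc, hd⟩ := hC.exists_infDist_eq_dist hne x
  obtain ⟨s, hs, hsupp, -, -⟩ := hCL hc
  set d := Metric.infDist x C
  have hd0 : 0 ≤ d := Metric.infDist_nonneg
  set z := cut x d with hz
  have hz0 : ∀ v, 0 ≤ z v := fun v => le_max_right _ _
  have hzs : ∀ v, z v ≠ 0 → v ∈ s := by
    intro v hv
    apply hsupp
    intro hcv
    apply hv
    have h1 := E1.abs_le (x - c) v
    rw [← dist_eq_norm, ← hd] at h1
    simp only [lp.coeFn_sub, Pi.sub_apply, hcv, sub_zero] at h1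
    rw [hz, cut_apply, abs_of_nonneg hd0]
    exact max_eq_right (by linarith [le_abs_self (x v)])
  have hnorm : ‖z‖ = ∑ v ∈ s, z v := by
    rw [E1.norm_eq, tsum_eq_sum (s := s)]
    · exact Finset.sum_congr rfl fun v _ => abs_of_nonneg (hz0 v)
    · intro v hv
      by_contra h
      exact hv (hzs v (by simpa using h))
  have hpos : 0 < ‖z‖ := norm_pos_iff.2 hx
  refine ⟨s, hs, ?_, ?_, ?_⟩
  · intro v hv
    apply hzs
    intro h
    apply hv
    simp [h]
  · intro v
    simp only [lp.coeFn_smul, Pi.smul_apply, smul_eq_mul]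
    exact mul_nonneg (inv_nonneg.2 hpos.le) (hz0 v)
  · simp only [lp.coeFn_smul, Pi.smul_apply, smul_eq_mul]
    rw [← Finset.mul_sum, ← hnorm, inv_mul_cancel₀ hpos.ne']

lemma space_nonneg {V : Type v} {L : SimpComplex V} {x : E1 V} (hx : x ∈ L.space) (v : V) :
    0 ≤ x v := by
  obtain ⟨s, -, -, h, -⟩ := hx
  exact h v

lemma space_norm {V : Type v} {L : SimpComplex V} {x : E1 V} (hx : x ∈ L.space) :
    ‖x‖ = 1 := by
  obtain ⟨s, -, hs, h, h1⟩ := hx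
  rw [E1.norm_eq, tsum_eq_sum (s := s), ← h1]
  · exact Finset.sum_congr rfl fun v _ => abs_of_nonneg (h v)
  · intro v hv
    by_contra h
    exact hv (hs v (by simpa using h))

/-- A metric simplicial complex is an absolute neighborhood extensor of compact Hausdorff
spaces. -/
lemma isANE_compact {K : Type u} [TopologicalSpace K] [CompactSpace K] [T2Space K]
    {V : Type v} (L : SimpComplex V) : IsANE ↥L.space K := by
  intro Y hY f
  rcases Y.eq_empty_or_nonempty with rfl | hne
  · exact ⟨∅, isOpen_empty, subset_rfl, ⟨fun x => x.2.elim, by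
      rw [continuous_iff_continuousAt]; exact fun x => x.2.elim⟩, fun y => y.2.elim⟩
  have : CompactSpace Y := isCompact_iff_compactSpace.1 hY.isCompact
  have hcf : Continuous fun y : Y => (f y : E1 V) := continuous_subtype_val.comp f.continuous
  obtain ⟨F, hF⟩ := tietze_banach hY (⟨_, hcf⟩ : C(Y, E1 V))
  simp only [ContinuousMap.coe_mk] at hF
  set C : Set (E1 V) := range fun y : Y => (f y : E1 V) with hCdef
  have hC : IsCompact C := isCompact_range hcf
  have hCL : C ⊆ L.space := by rintro _ ⟨y, rfl⟩; exact (f y).2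
  have hCne : C.Nonempty := by
    obtain ⟨y, hy⟩ := hne
    exact ⟨_, ⟨⟨y, hy⟩, rfl⟩⟩
  let G : K → E1 V := fun x => cut (F x) (Metric.infDist (F x) C)
  have hG : Continuous G := cut_cont.comp
    (F.continuous.prodMk ((Metric.continuous_infDist_pt C).comp F.continuous))
  have hGY : ∀ y : Y, G y = f y := by
    intro y
    have h0 : Metric.infDist (F y) C = 0 := by
      rw [hF]; exact Metric.infDist_zero_of_mem ⟨y, rfl⟩
    ext v
    simp only [G, h0, cut_apply, abs_zero, sub_zero]
    rw [hF]
    exact max_eq_left (space_nonneg (f y).2 v)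
  have hU : IsOpen {x | G x ≠ 0} := isOpen_ne_fun hG continuous_const
  refine ⟨{x | G x ≠ 0}, hU, fun y hy => ?_,
    ⟨fun x => ⟨‖G x‖⁻¹ • G x, cut_mem L hC hCL hCne (F x) x.2⟩, ?_⟩, fun y hy => ?_⟩
  · intro h0
    rw [hGY ⟨y, hy⟩] at h0
    have := space_norm (f ⟨y, hy⟩).2
    rw [h0] at this
    simp at this
  · refine Continuous.subtype_mk ?_ _
    have h1 : Continuous fun x : {x | G x ≠ 0} => G x := hG.comp continuous_subtype_val
    exact (h1.norm.inv₀ fun x => norm_ne_zero_iff.2 x.2).smul h1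
  · apply Subtype.ext
    simp only [ContinuousMap.coe_mk]
    rw [hGY, space_norm (f y).2]
    simp

lemma compact_range_of_cc {Y : Type u} [TopologicalSpace Y] [CountablyCompactSpace Y]
    {Z : Type w} [MetricSpace Z] (f : C(Y, Z)) : IsCompact (range f) := by
  rw [isCompact_iff_isSeqCompact, ← image_univ]
  exact (CountablyCompactSpace.isCountablyCompact_univ.image f.continuous).isSeqCompact

/-- A map with countably compact domain into a metric space extends over the Stone–Čech
compactification. -/
lemma exists_stoneCech_ext {Y : Type u} [TopologicalSpace Y] [CountablyCompactSpace Y]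
    {Z : Type w} [MetricSpace Z] (f : C(Y, Z)) :
    ∃ g : C(StoneCech Y, Z), ∀ y, g (stoneCechUnit y) = f y := by
  have : CompactSpace (range f) := isCompact_iff_compactSpace.1 (compact_range_of_cc f)
  have hc : Continuous (rangeFactorization f) := f.continuous.rangeFactorization
  refine ⟨⟨fun p => (stoneCechExtend hc p).1,
    continuous_subtype_val.comp (continuous_stoneCechExtend hc)⟩, fun y => ?_⟩
  simp [stoneCechExtend_stoneCechUnit]

/-- For `Y` closed in a normal space `X`, the map `βY → βX` is a closed embedding. -/
lemma exists_beta_embedding {X : Type u} [TopologicalSpace X] [NormalSpace X] {Y : Set X}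
    (hY : IsClosed Y) : ∃ e : StoneCech Y → StoneCech X, IsClosedEmbedding e ∧
      ∀ y : Y, e (stoneCechUnit y) = stoneCechUnit (y : X) := by
  have hc : Continuous fun y : Y => (stoneCechUnit (y : X) : StoneCech X) :=
    continuous_stoneCechUnit.comp continuous_subtype_val
  have he := continuous_stoneCechExtend hc
  refine ⟨stoneCechExtend hc, he.isClosedEmbedding ?_, stoneCechExtend_stoneCechUnit hc⟩
  intro p q hpq
  by_contra hne
  obtain ⟨φ, hφ0, hφ1, hφ⟩ := exists_continuous_zero_one_of_isClosed
    (isClosed_singleton (x := p)) (isClosed_singleton (x := q))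
    (disjoint_singleton.2 hne)
  let φ' : C(StoneCech Y, Icc (0:ℝ) 1) := ⟨fun x => ⟨φ x, hφ x⟩, by fun_prop⟩
  obtain ⟨ψ, hψ⟩ := ContinuousMap.exists_restrict_eq hY
    (φ'.comp ⟨stoneCechUnit, continuous_stoneCechUnit⟩)
  have hψc := ψ.continuous
  have key : stoneCechExtend hψc ∘ stoneCechExtend hc = φ' := by
    refine stoneCech_hom_ext ((continuous_stoneCechExtend hψc).comp he) φ'.continuous ?_
    funext y
    have := DFunLike.congr_fun hψ y
    simp only [Function.comp_apply, stoneCechExtend_stoneCechUnit]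
    exact this
  have h1 := congrFun key p
  have h2 := congrFun key q
  simp only [Function.comp_apply, hpq] at h1 h2
  have h3 : φ p = φ q := congrArg Subtype.val (h1.symm.trans h2)
  have h4 : φ p = 0 := hφ0 rfl
  have h5 : φ q = 1 := hφ1 rfl
  rw [h4, h5] at h3
  exact zero_ne_one h3

end AEproof

/-- For a countably compact normal Tychonoff space `X` and a simplicial complex `L` with
the metric topology, `L` is an absolute extensor of `X` iff it is an absolute extensor
of `βX`. -/
theorem isAE_iff_isAE_stoneCech (X : Type u) [TopologicalSpace X] [NormalSpace X]
    [T35Space X] (hX : CountablyCompact X) {V : Type v} (L : SimpComplex V) :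
    IsAE ↥L.space X ↔ IsAE ↥L.space (StoneCech X) := by
  have hcc : CountablyCompactSpace X := by
    refine ⟨isCountablyCompact_iff_countable_open_cover.2 fun U hU hc => ?_⟩
    obtain ⟨t, ht⟩ := hX U hU (univ_subset_iff.1 hc)
    exact ⟨t, ht.symm.subset⟩
  constructor
  · intro h Y hY f
    obtain ⟨U, hU, hYU, g, hg⟩ := isANE_compact L Y hY f
    obtain ⟨W, hW, hYW, hWU⟩ := normal_exists_closure_subset hY hU hYU
    let i : X → StoneCech X := stoneCechUnit
    have hi : Continuous i := continuous_stoneCechUnit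
    obtain ⟨k, hk⟩ := h (i ⁻¹' closure W) (isClosed_closure.preimage hi)
      ⟨fun x => g ⟨i x, hWU x.2⟩, by fun_prop⟩
    obtain ⟨G, hG⟩ := exists_stoneCech_ext k
    refine ⟨G, fun y => ?_⟩
    -- agreement of `G` and `g` on `W`
    have hagree : ∀ p : W, G p = g ⟨p, hWU (subset_closure p.2)⟩ := by
      have hd : Dense (Subtype.val ⁻¹' range i : Set W) :=
        Dense.preimage denseRange_stoneCechUnit hW.isOpenMap_subtype_val
      have hc1 : Continuous fun p : W => G p := by fun_prop
      have hc2 : Continuous fun p : W => g ⟨p, hWU (subset_closure p.2)⟩ := by fun_prop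
      refine fun p => congrFun (hc1.ext_on hd hc2 ?_) p
      rintro ⟨_, hp⟩ ⟨x, rfl⟩
      exact (hG x).trans (hk ⟨x, subset_closure hp⟩)
    rw [hagree ⟨y, hYW y.2⟩]
    exact hg y _
  · intro h Y hY f
    have : CountablyCompactSpace Y :=
      isCountablyCompact_iff_countablyCompactSpace.1 hY.isCountablyCompact
    obtain ⟨g, hg⟩ := exists_stoneCech_ext f
    obtain ⟨e, he, heY⟩ := exists_beta_embedding hY
    let H := he.isEmbedding.toHomeomorph
    obtain ⟨G, hG⟩ := h (range e) he.isClosed_range ⟨fun x => g (H.symm x), by fun_prop⟩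
    refine ⟨⟨fun x => G (stoneCechUnit x), G.continuous.comp continuous_stoneCechUnit⟩,
      fun y => ?_⟩
    have h1 := hG (H (stoneCechUnit y))
    simp only [ContinuousMap.coe_mk, Homeomorph.symm_apply_apply, hg] at h1
    rw [← h1, ContinuousMap.coe_mk, ← heY]
    rfl
end

section
/- Let X be a countably compact normal space, F a closed subset of X, and U = X \ F. Suppose a simplicial complex L is an absolute extensor of F and an absolute extensor of every subset Y ⊆ U that is closed in X. Then L is an absolute extensor of X. -/
open Set Topology

universe u v w

/-- Countable compactness in the sense of the frozen definition yields compact images in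
metric spaces. -/
theorem compact_range_aux {X : Type*} [TopologicalSpace X] (hX : CountablyCompact X)
    {M : Type*} [MetricSpace M] (Y : Set X) (hY : IsClosed Y) (f : C(Y, M)) :
    IsCompact (range f) := by
  apply IsSeqCompact.isCompact
  intro u hu
  choose y hy using hu
  have hcl : ∃ x : X, MapClusterPt x Filter.atTop (fun n => (y n : X)) := by
    by_contra hcon
    push Not at hcon
    obtain ⟨t, ht⟩ := hX (fun n => (closure ((fun n => (y n : X)) '' Ici n))ᶜ)
      (fun n => isClosed_closure.isOpen_compl) (by
        rw [eq_univ_iff_forall]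
        intro x
        have := hcon x
        rw [mapClusterPt_atTop_iff_forall_mem_closure] at this
        push Not at this
        obtain ⟨n, hn⟩ := this
        exact mem_iUnion.2 ⟨n, hn⟩)
    have hm : (y (t.sup id) : X) ∈ ⋃ n ∈ t, (closure ((fun n => (y n : X)) '' Ici n))ᶜ := by
      rw [ht]; trivial
    simp only [mem_iUnion] at hm
    obtain ⟨n, hn, h⟩ := hm
    exact h (subset_closure ⟨t.sup id, Finset.le_sup (f := id) hn, rfl⟩)
  obtain ⟨x, hx⟩ := hcl
  have hxY : x ∈ Y := by
    rw [mapClusterPt_atTop_iff_forall_mem_closure] at hx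
    have := hx 0
    refine hY.closure_subset_iff.2 ?_ this
    rintro _ ⟨n, -, rfl⟩
    exact (y n).2
  have hx' : MapClusterPt (⟨x, hxY⟩ : Y) Filter.atTop y := by
    rw [mapClusterPt_iff_frequently] at hx ⊢
    intro s hs
    rw [nhds_subtype_eq_comap] at hs
    obtain ⟨s', hs', hss⟩ := hs
    exact (hx s' hs').mono fun n hn => hss hn
  have h2 := hx'.continuousAt_comp f.continuous.continuousAt
  have h3 : f ∘ y = u := funext hy
  rw [h3] at h2
  obtain ⟨ψ, hψ, hlim⟩ := h2.tendsto_subseq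
  exact ⟨_, ⟨_, rfl⟩, ψ, hψ, hlim⟩

theorem clip_aux {X : Type*} [TopologicalSpace X] {E : Type*} [NormedAddCommGroup E]
    [NormedSpace ℝ E] (G : C(X, E)) (r : ℝ) (hr : 0 < r) :
    ∃ H : BoundedContinuousFunction X E, (∀ x, ‖H x‖ ≤ r) ∧ ∀ x, ‖G x‖ ≤ r → H x = G x := by
  have hpos : ∀ x, 0 < max r ‖G x‖ := fun x => lt_max_of_lt_left hr
  have hc : Continuous fun x => (r / max r ‖G x‖) • G x := by
    refine Continuous.smul (Continuous.div continuous_const ?_ fun x => (hpos x).ne') G.continuous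
    exact continuous_const.max G.continuous.norm
  have hb : ∀ x, ‖(r / max r ‖G x‖) • G x‖ ≤ r := by
    intro x
    rw [norm_smul, Real.norm_eq_abs, abs_of_nonneg (div_nonneg hr.le (hpos x).le),
      div_mul_eq_mul_div, div_le_iff₀ (hpos x)]
    exact mul_le_mul_of_nonneg_left (le_max_right _ _) hr.le
  refine ⟨BoundedContinuousFunction.ofNormedAddCommGroup _ hc r hb, hb, fun x hx => ?_⟩
  change (r / max r ‖G x‖) • G x = G x
  rw [max_eq_left hx, div_self hr.ne', one_smul]

/-- Tietze extension for maps with compact range into a Banach space. -/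
theorem tietze_banach_aux {X : Type*} [TopologicalSpace X] [NormalSpace X]
    {E : Type*} [NormedAddCommGroup E] [NormedSpace ℝ E] [CompleteSpace E]
    (Y : Set X) (hY : IsClosed Y) (f : C(Y, E)) (hf : IsCompact (range f)) :
    ∃ g : C(X, E), ∀ y : Y, g y = f y := by
  classical
  let ι : C(Y, X) := ⟨Subtype.val, continuous_subtype_val⟩
  let R : NormedAddGroupHom (BoundedContinuousFunction X E) (BoundedContinuousFunction Y E) :=
    { toFun := fun h => h.compContinuous ι
      map_add' := fun a b => rfl
      bound' := ⟨1, fun h => by simpa using h.norm_compContinuous_le ι⟩ }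
  let K : AddSubgroup (BoundedContinuousFunction Y E) :=
    { carrier := {h | ∃ G : C(X, E), ∀ y : Y, G y = h y}
      zero_mem' := ⟨0, fun y => rfl⟩
      add_mem' := by
        rintro a b ⟨A, hA⟩ ⟨B, hB⟩
        exact ⟨A + B, fun y => by simp [hA, hB]⟩
      neg_mem' := by
        rintro a ⟨A, hA⟩
        exact ⟨-A, fun y => by simp [hA]⟩ }
  have hsurj : R.SurjectiveOnWith K 1 := by
    rintro h ⟨G, hG⟩
    by_cases h0 : h = 0
    · exact ⟨0, by simp [h0], by simp⟩
    have hr : 0 < ‖h‖ := norm_pos_iff.2 h0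
    obtain ⟨H, hH, hHG⟩ := clip_aux G ‖h‖ hr
    refine ⟨H, ?_, ?_⟩
    · ext1 y
      change H y = h y
      rw [hHG, hG]
      rw [hG]
      exact h.norm_coe_le_norm y
    · rw [one_mul]
      exact (BoundedContinuousFunction.norm_le hr.le).2 hH
  have hcl := controlled_closure_of_complete one_pos one_pos hsurj
  obtain ⟨C, hC⟩ := hf.isBounded.exists_norm_le
  let fb : BoundedContinuousFunction Y E :=
    BoundedContinuousFunction.ofNormedAddCommGroup f f.continuous C fun y => hC _ ⟨y, rfl⟩
  have hfb : fb ∈ K.topologicalClosure := by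
    change fb ∈ closure (K : Set (BoundedContinuousFunction Y E))
    rw [Metric.mem_closure_iff]
    intro ε hε
    have hfin := (Metric.totallyBounded_iff.1 hf.totallyBounded (ε / 2) (half_pos hε))
    obtain ⟨t, htf, ht⟩ := hfin
    lift t to Finset E using htf
    let φ : E → C(Y, ℝ) := fun k =>
      ⟨fun y => max (ε / 2 - dist (f y) k) 0, by fun_prop⟩
    have hφ0 : ∀ k y, 0 ≤ φ k y := fun k y => le_max_right _ _
    have hS : ∀ y, 0 < ∑ k ∈ t, φ k y := by
      intro y
      have := ht ⟨y, rfl⟩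
      simp only [mem_iUnion] at this
      obtain ⟨k, hk, hky⟩ := this
      refine Finset.sum_pos' (fun k _ => hφ0 k y) ⟨k, hk, lt_max_of_lt_left ?_⟩
      rw [Metric.mem_ball] at hky
      linarith
    let lam : E → C(Y, ℝ) := fun k =>
      ⟨fun y => φ k y / ∑ k ∈ t, φ k y, by
        refine Continuous.div (φ k).continuous ?_ fun y => (hS y).ne'
        exact continuous_finsetSum _ fun k _ => (φ k).continuous⟩
    have hl0 : ∀ k y, 0 ≤ lam k y := fun k y => div_nonneg (hφ0 k y) (hS y).le
    have hl1 : ∀ y, ∑ k ∈ t, lam k y = 1 := by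
      intro y
      change ∑ k ∈ t, φ k y / ∑ k ∈ t, φ k y = 1
      rw [← Finset.sum_div, div_self (hS y).ne']
    have hlext : ∀ k, ∃ g : C(X, ℝ), g.restrict Y = lam k := fun k =>
      ContinuousMap.exists_restrict_eq hY (lam k)
    choose Λ hΛ using hlext
    have hΛ' : ∀ k (y : Y), Λ k y = lam k y := fun k y => by rw [← hΛ k]; rfl
    let G : C(X, E) := ⟨fun x => ∑ k ∈ t, Λ k x • k, by fun_prop⟩
    have hest : ∀ y : Y, ‖f y - G y‖ ≤ ε / 2 := by
      intro y
      have e1 : f y - G y = ∑ k ∈ t, lam k y • (f y - k) := by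
        change f y - ∑ k ∈ t, Λ k y • k = _
        simp only [smul_sub, Finset.sum_sub_distrib, ← Finset.sum_smul, hl1, one_smul, hΛ']
      rw [e1]
      calc ‖∑ k ∈ t, lam k y • (f y - k)‖ ≤ ∑ k ∈ t, ‖lam k y • (f y - k)‖ := norm_sum_le _ _
        _ ≤ ∑ k ∈ t, lam k y * (ε / 2) := by
          refine Finset.sum_le_sum fun k _ => ?_
          rw [norm_smul, Real.norm_eq_abs, abs_of_nonneg (hl0 k y)]
          by_cases hd : dist (f y) k ≤ ε / 2
          · rw [← dist_eq_norm]
            exact mul_le_mul_of_nonneg_left hd (hl0 k y)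
          · have : lam k y = 0 := by
              change max (ε / 2 - dist (f y) k) 0 / _ = 0
              rw [max_eq_right (by linarith), zero_div]
            simp [this]
        _ = ε / 2 := by rw [← Finset.sum_mul, hl1, one_mul]
    let Gb : BoundedContinuousFunction Y E :=
      BoundedContinuousFunction.ofNormedAddCommGroup (fun y : Y => G y)
        (G.continuous.comp continuous_subtype_val) (C + ε / 2) (by
          intro y
          have h1 := hest y
          have h2 : ‖f y‖ ≤ C := hC _ ⟨y, rfl⟩
          calc ‖G y‖ = ‖f y - (f y - G y)‖ := by rw [sub_sub_cancel]
            _ ≤ ‖f y‖ + ‖f y - G y‖ := norm_sub_le _ _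
            _ ≤ _ := by linarith)
    refine ⟨Gb, ⟨G, fun y => rfl⟩, ?_⟩
    refine lt_of_le_of_lt ((BoundedContinuousFunction.dist_le (half_pos hε).le).2 fun y => ?_)
      (half_lt_self hε)
    rw [dist_eq_norm]
    exact hest y
  obtain ⟨g, hg, -⟩ := hcl fb hfb
  refine ⟨g.toContinuousMap, fun y => ?_⟩
  have : (R g) y = fb y := by rw [hg]
  exact this

section shrink

variable {V : Type*}

theorem l1_summable (x : lp (fun _ : V => ℝ) 1) : Summable fun v => |x v| := by
  have := (lp.memℓp x).summable (by simp)
  simpa using this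

theorem l1_norm (x : lp (fun _ : V => ℝ) 1) : ‖x‖ = ∑' v, |x v| := by
  have := lp.norm_eq_tsum_rpow (p := 1) (by simp) x
  simpa using this

theorem shrink_bound (a t : ℝ) : |max (a - |t|) 0| ≤ |a| := by
  rw [abs_of_nonneg (le_max_right _ _)]
  exact max_le (by linarith [le_abs_self a, abs_nonneg t]) (abs_nonneg a)

/-- Truncation `x ↦ (x - |t|)⁺` on `ℓ¹`. -/
noncomputable def shrinkMap (x : lp (fun _ : V => ℝ) 1) (t : ℝ) : lp (fun _ : V => ℝ) 1 :=
  ⟨fun v => max (x v - |t|) 0, by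
    apply memℓp_gen
    have : Summable fun v => |max (x v - |t|) 0| :=
      Summable.of_nonneg_of_le (fun _ => abs_nonneg _) (fun v => shrink_bound (x v) t)
        (l1_summable x)
    simpa using this⟩

theorem shrinkMap_apply (x : lp (fun _ : V => ℝ) 1) (t : ℝ) (v : V) :
    shrinkMap x t v = max (x v - |t|) 0 := rfl

theorem shrinkMap_lip (x y : lp (fun _ : V => ℝ) 1) (t : ℝ) :
    ‖shrinkMap x t - shrinkMap y t‖ ≤ ‖x - y‖ := by
  rw [l1_norm, l1_norm]
  refine (l1_summable _).tsum_le_tsum (fun v => ?_) (l1_summable _)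
  simp only [lp.coeFn_sub, Pi.sub_apply, shrinkMap_apply]
  refine (abs_max_sub_max_le_abs _ _ _).trans ?_
  simp

theorem shrinkMap_cont_right (x : lp (fun _ : V => ℝ) 1) (t₀ : ℝ) :
    Filter.Tendsto (fun t => ‖shrinkMap x t - shrinkMap x t₀‖) (𝓝 t₀) (𝓝 0) := by
  have h : Filter.Tendsto (fun t => ∑' v, |max (x v - |t|) 0 - max (x v - |t₀|) 0|) (𝓝 t₀)
      (𝓝 (∑' _ : V, (0 : ℝ))) := by
    refine tendsto_tsum_of_dominated_convergence (bound := fun v => |x v| + |x v|)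
      ((l1_summable x).add (l1_summable x)) (fun v => ?_) (Filter.Eventually.of_forall fun t v => ?_)
    · have : Continuous fun t : ℝ => |max (x v - |t|) 0 - max (x v - |t₀|) 0| := by fun_prop
      simpa using this.tendsto t₀
    · rw [Real.norm_eq_abs, abs_abs]
      exact (abs_sub _ _).trans (add_le_add (shrink_bound _ _) (shrink_bound _ _))
  rw [tsum_zero] at h
  refine h.congr fun t => ?_
  rw [l1_norm]
  rfl

theorem shrinkMap_continuous :
    Continuous fun p : lp (fun _ : V => ℝ) 1 × ℝ => shrinkMap p.1 p.2 := by
  rw [continuous_iff_continuousAt]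
  rintro ⟨x, t⟩
  rw [ContinuousAt, tendsto_iff_norm_sub_tendsto_zero]
  have h1 : Filter.Tendsto (fun p : lp (fun _ : V => ℝ) 1 × ℝ =>
      ‖p.1 - x‖ + ‖shrinkMap x p.2 - shrinkMap x t‖) (𝓝 (x, t)) (𝓝 (0 + 0)) := by
    refine Filter.Tendsto.add ?_ ?_
    · have : Continuous fun p : lp (fun _ : V => ℝ) 1 × ℝ => ‖p.1 - x‖ := by fun_prop
      simpa using this.tendsto (x, t)
    · exact (shrinkMap_cont_right x t).comp (continuous_snd.tendsto (x, t))
  rw [add_zero] at h1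
  refine squeeze_zero (fun _ => norm_nonneg _) (fun p => ?_) h1
  calc ‖shrinkMap p.1 p.2 - shrinkMap x t‖
      = ‖(shrinkMap p.1 p.2 - shrinkMap x p.2) + (shrinkMap x p.2 - shrinkMap x t)‖ := by
        rw [sub_add_sub_cancel]
    _ ≤ _ := (norm_add_le _ _).trans (add_le_add (shrinkMap_lip _ _ _) le_rfl)

theorem l1_norm_finset (x : lp (fun _ : V => ℝ) 1) (s : Finset V) (h0 : ∀ v, 0 ≤ x v)
    (hs : ∀ v, x v ≠ 0 → v ∈ s) : ‖x‖ = ∑ v ∈ s, x v := by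
  rw [l1_norm, tsum_eq_sum (s := s)]
  · exact Finset.sum_congr rfl fun v _ => abs_of_nonneg (h0 v)
  · intro v hv
    by_contra h
    exact hv (hs v fun h' => h (by rw [h', abs_zero]))

end shrink

/-- A metric simplicial complex is an absolute neighborhood extensor of countably compact normal
spaces. -/
theorem isANE_aux {X : Type*} [TopologicalSpace X] [NormalSpace X] (hX : CountablyCompact X)
    {V : Type*} (L : SimpComplex V) : IsANE L.space X := by
  intro Y hY f
  rcases Y.eq_empty_or_nonempty with rfl | hne
  · refine ⟨∅, isOpen_empty, subset_rfl, ⟨fun x => x.2.elim, ?_⟩, fun y => y.2.elim⟩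
    exact continuous_of_const fun x => x.2.elim
  let f' : C(Y, lp (fun _ : V => ℝ) 1) := ⟨fun y => f y, by fun_prop⟩
  have hK := compact_range_aux hX Y hY f'
  obtain ⟨g, hg⟩ := tietze_banach_aux Y hY f' hK
  have hKne : (range f').Nonempty := ⟨_, ⟨⟨_, hne.some_mem⟩, rfl⟩⟩
  let d : X → ℝ := fun x => Metric.infDist (g x) (range f')
  have hd : Continuous d := (Metric.continuous_infDist_pt _).comp g.continuous
  have hd0 : ∀ x, 0 ≤ d x := fun x => Metric.infDist_nonneg
  let q : X → lp (fun _ : V => ℝ) 1 := fun x => shrinkMap (g x) (2 * d x)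
  have hq : Continuous q :=
    shrinkMap_continuous.comp (g.continuous.prodMk (continuous_const.mul hd))
  have hq0 : ∀ x v, 0 ≤ q x v := fun x v => le_max_right _ _
  -- support of `q x` lies in a face
  have hsupp : ∀ x, ∃ s ∈ L.faces, ∀ v, q x v ≠ 0 → v ∈ s := by
    intro x
    have hp : ∃ p ∈ range f', ‖g x - p‖ ≤ 2 * d x := by
      rcases (hd0 x).eq_or_lt with h | h
      · have : g x ∈ range f' := (hK.isClosed.mem_iff_infDist_zero hKne).2 h.symm
        exact ⟨g x, this, by simp [← h]⟩
      · obtain ⟨p, hp, hlt⟩ := (Metric.infDist_lt_iff hKne (x := g x) (r := 2 * d x)).1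
          (by change d x < _; linarith)
        exact ⟨p, hp, by rw [← dist_eq_norm]; exact hlt.le⟩
    obtain ⟨p, ⟨y, rfl⟩, hle⟩ := hp
    obtain ⟨s, hs, hsup, hnn, -⟩ := (f y).2
    refine ⟨s, hs, fun v hv => hsup v fun hz => hv ?_⟩
    change max (g x v - |2 * d x|) 0 = 0
    rw [abs_of_nonneg (by linarith [hd0 x])]
    apply max_eq_right
    have h1 : |(g x - f' y) v| ≤ ‖g x - f' y‖ := by
      simpa using lp.norm_apply_le_norm (p := 1) (by simp) (g x - f' y) v
    have h2 : (g x - f' y) v = g x v := by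
      rw [lp.coeFn_sub, Pi.sub_apply]
      have : f' y v = 0 := hz
      rw [this, sub_zero]
    rw [h2] at h1
    linarith [le_abs_self (g x v)]
  have hqY : ∀ y : Y, q y = f y := by
    intro y
    have hdy : d y = 0 := by
      change Metric.infDist (g y) _ = 0
      rw [hg]
      exact Metric.infDist_zero_of_mem ⟨y, rfl⟩
    obtain ⟨s, hs, hsup, hnn, -⟩ := (f y).2
    ext v
    change max (g y v - |2 * d y|) 0 = _
    rw [hdy, hg]
    simp only [mul_zero, abs_zero, sub_zero]
    exact max_eq_left (hnn v)
  have hnorm : ∀ y : Y, ‖(f y : lp (fun _ : V => ℝ) 1)‖ = 1 := by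
    intro y
    obtain ⟨s, hs, hsup, hnn, h1⟩ := (f y).2
    rw [l1_norm_finset _ s hnn hsup, h1]
  have hmem : ∀ x, q x ≠ 0 → ‖q x‖⁻¹ • q x ∈ L.space := by
    intro x hx
    obtain ⟨s, hs, hsup⟩ := hsupp x
    have hpos : 0 < ‖q x‖ := norm_pos_iff.2 hx
    refine ⟨s, hs, fun v hv => hsup v fun h => hv ?_, fun v => ?_, ?_⟩
    · simp [h]
    · simp only [lp.coeFn_smul, Pi.smul_apply, smul_eq_mul]
      exact mul_nonneg (inv_nonneg.2 hpos.le) (hq0 x v)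
    · simp only [lp.coeFn_smul, Pi.smul_apply, smul_eq_mul]
      rw [← Finset.mul_sum, ← l1_norm_finset (q x) s (hq0 x) hsup, inv_mul_cancel₀ hpos.ne']
  refine ⟨{x | q x ≠ 0}, isOpen_ne_fun hq continuous_const, ?_,
    ⟨fun x => ⟨‖q x‖⁻¹ • q x, hmem x x.2⟩, ?_⟩, ?_⟩
  · intro y hy h
    have := hnorm ⟨y, hy⟩
    rw [← hqY ⟨y, hy⟩] at this
    have h : q y = 0 := h
    rw [h, norm_zero] at this
    exact zero_ne_one this
  · refine Continuous.subtype_mk ?_ _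
    have hqs : Continuous fun x : {x | q x ≠ 0} => q x := hq.comp continuous_subtype_val
    exact (hqs.norm.inv₀ fun x => norm_ne_zero_iff.2 x.2).smul hqs
  · intro y h
    apply Subtype.ext
    change ‖q y‖⁻¹ • q y = f y
    rw [hqY, hnorm, inv_one, one_smul]

theorem paste_aux {T Z : Type*} [TopologicalSpace T] [TopologicalSpace Z] (A B : Set T)
    (hA : IsClosed A) (hB : IsClosed B) (hAB : ∀ x, x ∈ A ∨ x ∈ B) (f : C(A, Z)) (g : C(B, Z))
    (hfg : ∀ x (ha : x ∈ A) (hb : x ∈ B), f ⟨x, ha⟩ = g ⟨x, hb⟩) :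
    ∃ h : C(T, Z), (∀ a : A, h a = f a) ∧ ∀ b : B, h b = g b := by
  classical
  let h : T → Z := fun x => if ha : x ∈ A then f ⟨x, ha⟩ else g ⟨x, (hAB x).resolve_left ha⟩
  have h1 : ∀ a : A, h a = f a := fun a => dif_pos a.2
  have h2 : ∀ b : B, h b = g b := by
    intro b
    by_cases ha : (b : T) ∈ A
    · exact (dif_pos ha).trans (hfg b ha b.2)
    · exact dif_neg ha
  have c1 : ContinuousOn h A := by
    rw [continuousOn_iff_continuous_domRestrict]
    exact f.continuous.congr fun a => (h1 a).symm
  have c2 : ContinuousOn h B := by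
    rw [continuousOn_iff_continuous_domRestrict]
    exact g.continuous.congr fun a => (h2 a).symm
  have c : Continuous h := by
    rw [← continuousOn_univ, ← (eq_univ_of_forall hAB : A ∪ B = univ)]
    exact c1.union_of_isClosed c2 hA hB
  exact ⟨⟨h, c⟩, h1, h2⟩

/-- If a simplicial complex `L` is an absolute extensor of a closed set `F` in a countably
compact normal space `X` and of every subset of `X \ F` that is closed in `X`, then `L` is
an absolute extensor of `X`. -/
theorem isAE_of_closed_and_complement (X : Type u) [TopologicalSpace X] [NormalSpace X]
    (hX : CountablyCompact X) {V : Type v} (L : SimpComplex V)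
    (F : Set X) (hF : IsClosed F)
    (hAEF : IsAE ↥L.space ↥F)
    (hAEU : ∀ Y : Set X, Y ⊆ Fᶜ → IsClosed Y → IsAE ↥L.space ↥Y) :
    IsAE ↥L.space X := by
  intro Y hY f
  -- extend over `F`
  obtain ⟨f1, hf1⟩ := hAEF (Subtype.val ⁻¹' Y) (hY.preimage continuous_subtype_val)
    ⟨fun x => f ⟨x.1.1, x.2⟩, by fun_prop⟩
  -- paste to a map on `Y ∪ F`
  obtain ⟨f2, hf2, -⟩ := paste_aux (T := ↥(Y ∪ F)) (Subtype.val ⁻¹' Y) (Subtype.val ⁻¹' F)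
    (hY.preimage continuous_subtype_val) (hF.preimage continuous_subtype_val) (fun x => x.2)
    ⟨fun x => f ⟨x.1.1, x.2⟩, by fun_prop⟩ ⟨fun x => f1 ⟨x.1.1, x.2⟩, by fun_prop⟩
    (fun x ha hb => (hf1 ⟨⟨x.1, hb⟩, ha⟩).symm)
  obtain ⟨U, hU, hYU, g, hg⟩ := isANE_aux hX L (Y ∪ F) (hY.union hF) f2
  obtain ⟨W, hW, hYW, hWU⟩ := normal_exists_closure_subset (hY.union hF) hU hYU
  -- extend over the complement of `W`
  obtain ⟨k, hk⟩ := hAEU Wᶜ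
    (compl_subset_compl.2 (subset_union_right.trans hYW)) hW.isClosed_compl
    (Subtype.val ⁻¹' closure W) (isClosed_closure.preimage continuous_subtype_val)
    ⟨fun x => g ⟨x.1.1, hWU x.2⟩, by fun_prop⟩
  obtain ⟨h, hh, -⟩ := paste_aux (closure W) Wᶜ isClosed_closure hW.isClosed_compl
    (fun x => (em (x ∈ W)).imp (fun h => subset_closure h) id)
    ⟨fun x => g ⟨x.1, hWU x.2⟩, by fun_prop⟩ k
    (fun x ha hb => (hk ⟨⟨x, hb⟩, ha⟩).symm)
  refine ⟨h, fun y => ?_⟩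
  have hyW : (y : X) ∈ closure W := subset_closure (hYW (Or.inl y.2))
  have e1 := hh ⟨y, hyW⟩
  have e2 := hg ⟨y, Or.inl y.2⟩ (hWU hyW)
  have e3 := hf2 ⟨⟨y, Or.inl y.2⟩, y.2⟩
  exact e1.trans (e2.trans e3)
end

section
/- Suppose a normal countably compact space X is the union of countably many closed subsets X_i (i ∈ ℕ), and L is a simplicial complex that is an absolute extensor of each X_i. Then L is an absolute extensor of X. -/
open Set Topology

universe u v w

namespace CST

open Filter

abbrev E (V : Type v) := lp (fun _ : V => ℝ) 1

variable {V : Type v}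

theorem summable_abs (x : E V) : Summable fun v => |x v| := by
  have := (lp.memℓp x).summable (by simp)
  simpa using this

theorem norm_eq (x : E V) : ‖x‖ = ∑' v, |x v| := by
  have := lp.norm_eq_tsum_rpow (p := 1) (by simp) x
  simpa using this

theorem abs_le_norm (x : E V) (v : V) : |x v| ≤ ‖x‖ := by
  simpa using lp.norm_apply_le_norm (p := 1) (by simp) x v

theorem norm_mono {x y : E V} (h : ∀ v, |x v| ≤ |y v|) : ‖x‖ ≤ ‖y‖ :=
  lp.norm_mono (by simp) (by simpa using h)

/-- soft thresholding -/
noncomputable def soft (x : E V) (s : ℝ) : E V :=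
  ⟨fun v => max (x v - max s 0) 0, (lp.memℓp x).mono' fun v => by
    simp only [Real.norm_eq_abs]
    rw [abs_of_nonneg (le_max_right _ _)]
    exact max_le (by linarith [le_abs_self (x v), le_max_right s 0]) (abs_nonneg _)⟩

theorem soft_apply (x : E V) (s : ℝ) (v : V) : soft x s v = max (x v - max s 0) 0 := rfl

theorem norm_soft_sub (x y : E V) (s : ℝ) : ‖soft x s - soft y s‖ ≤ ‖x - y‖ := by
  refine norm_mono fun v => ?_
  simp only [lp.coeFn_sub, Pi.sub_apply, soft_apply]
  have := abs_max_sub_max_le_abs (x v - max s 0) (y v - max s 0) 0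
  simpa using this

theorem continuous_soft_right (x : E V) : Continuous fun s => soft x s := by
  rw [continuous_iff_continuousAt]
  intro s
  rw [ContinuousAt, tendsto_iff_norm_sub_tendsto_zero]
  simp only [norm_eq]
  have := tendsto_tsum_of_dominated_convergence (𝓕 := 𝓝 s)
    (f := fun t v => |(soft x t - soft x s) v|) (g := fun _ => 0) (summable_abs x) ?_ ?_
  · simpa using this
  · intro v
    have : Continuous fun t => |(soft x t - soft x s) v| := by
      simp only [lp.coeFn_sub, Pi.sub_apply, soft_apply]
      fun_prop
    have := this.tendsto s
    simpa using this
  · refine Eventually.of_forall fun t v => ?_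
    simp only [lp.coeFn_sub, Pi.sub_apply, soft_apply, Real.norm_eq_abs, abs_abs]
    have h1 : ∀ t : ℝ, max (x v - max t 0) 0 ≤ |x v| := fun t =>
      max_le (by linarith [le_abs_self (x v), le_max_right t 0]) (abs_nonneg _)
    have h2 : ∀ t : ℝ, 0 ≤ max (x v - max t 0) 0 := fun t => le_max_right _ _
    rw [abs_le]
    constructor <;> linarith [h1 s, h1 t, h2 s, h2 t]

theorem continuous_soft : Continuous fun p : E V × ℝ => soft p.1 p.2 := by
  rw [continuous_iff_continuousAt]
  rintro ⟨x, s⟩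
  rw [ContinuousAt, tendsto_iff_norm_sub_tendsto_zero]
  have h1 : Tendsto (fun p : E V × ℝ => ‖p.1 - x‖ + ‖soft x p.2 - soft x s‖) (𝓝 (x, s)) (𝓝 0) := by
    have : Continuous (fun p : E V × ℝ => ‖p.1 - x‖ + ‖soft x p.2 - soft x s‖) := by
      have := (continuous_soft_right x).comp (continuous_snd (X := E V))
      simp only [Function.comp_def] at this
      fun_prop
    simpa using this.tendsto (x, s)
  refine squeeze_zero (fun _ => norm_nonneg _) (fun p => ?_) h1
  calc _ = ‖(soft p.1 p.2 - soft x p.2) + (soft x p.2 - soft x s)‖ := by simp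
    _ ≤ _ := (norm_add_le _ _).trans (by gcongr; exact norm_soft_sub _ _ _)

/-- admissible thresholds -/
def Adm (L : SimpComplex V) (x : E V) : Set ℝ :=
  {t | 0 ≤ t ∧ ∀ u : Finset V, u.Nonempty → (∀ v ∈ u, t < x v) → u ∈ L.faces}

noncomputable def thr (L : SimpComplex V) (x : E V) : ℝ := sInf (Adm L x)

theorem adm_nonempty (L : SimpComplex V) (x : E V) : (Adm L x).Nonempty := by
  refine ⟨‖x‖, norm_nonneg _, fun u ⟨v, hv⟩ h => ?_⟩
  have := h v hv
  have h2 := abs_le_norm x v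
  linarith [le_abs_self (x v)]

theorem adm_bdd (L : SimpComplex V) (x : E V) : BddBelow (Adm L x) := ⟨0, fun _ h => h.1⟩

theorem thr_nonneg (L : SimpComplex V) (x : E V) : 0 ≤ thr L x :=
  le_csInf (adm_nonempty L x) fun _ h => h.1

theorem thr_le (L : SimpComplex V) (x y : E V) : thr L x ≤ thr L y + dist x y := by
  rw [← sub_le_iff_le_add]
  refine le_csInf (adm_nonempty L y) fun t ht => ?_
  rw [sub_le_iff_le_add]
  refine csInf_le (adm_bdd L x) ⟨add_nonneg ht.1 dist_nonneg, fun u hu h => ht.2 u hu fun v hv => ?_⟩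
  have h1 := h v hv
  have h2 := abs_le_norm (x - y) v
  rw [← dist_eq_norm] at h2
  simp only [lp.coeFn_sub, Pi.sub_apply] at h2
  linarith [le_abs_self (x v - y v)]

theorem continuous_thr (L : SimpComplex V) : Continuous (thr L) :=
  (LipschitzWith.of_le_add (thr_le L)).continuous

theorem thr_eq_zero (L : SimpComplex V) {x : E V} (hx : x ∈ L.space) : thr L x = 0 := by
  refine le_antisymm (csInf_le (adm_bdd L x) ⟨le_rfl, fun u hu h => ?_⟩) (thr_nonneg L x)
  obtain ⟨s, hs, h1, h2, h3⟩ := hx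
  exact L.down_closed s hs u (fun v hv => h1 v (h v hv).ne') hu

theorem norm_of_support {x : E V} {s : Finset V} (h1 : ∀ v, x v ≠ 0 → v ∈ s)
    (h2 : ∀ v, 0 ≤ x v) : ‖x‖ = ∑ v ∈ s, x v := by
  rw [norm_eq, tsum_eq_sum (s := s)]
  · exact Finset.sum_congr rfl fun v _ => abs_of_nonneg (h2 v)
  · intro v hv
    by_contra h
    exact hv (h1 v (by simpa using h))

theorem soft_thr_mem (L : SimpComplex V) {x : E V} (hx : x ∈ L.space) : soft x 0 = x := by
  obtain ⟨s, hs, h1, h2, h3⟩ := hx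
  apply lp.ext
  funext v
  rw [soft_apply]
  simpa using h2 v

theorem norm_mem (L : SimpComplex V) {x : E V} (hx : x ∈ L.space) : ‖x‖ = 1 := by
  obtain ⟨s, hs, h1, h2, h3⟩ := hx
  rw [norm_of_support h1 h2, h3]

theorem normalized_mem (L : SimpComplex V) {x : E V} {s : ℝ} (hs : thr L x < s)
    (h0 : soft x s ≠ 0) : ‖soft x s‖⁻¹ • soft x s ∈ L.space := by
  have hs0 : 0 < s := (thr_nonneg L x).trans_lt hs
  have hfin : {v | s < x v}.Finite := by
    have := (summable_abs x).tendsto_cofinite_zero.eventually (gt_mem_nhds hs0)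
    refine Set.Finite.subset (Filter.eventually_cofinite.1 this) fun v hv => ?_
    simp only [mem_ofPred_eq, not_lt] at hv ⊢
    exact hv.le.trans (le_abs_self _)
  have hsup : ∀ v, soft x s v ≠ 0 → v ∈ hfin.toFinset := by
    intro v hv
    simp only [Finite.mem_toFinset, mem_ofPred_eq]
    by_contra h
    apply hv
    rw [soft_apply, max_eq_left hs0.le]
    exact max_eq_right (by linarith)
  have hpos : ∀ v, 0 ≤ soft x s v := fun v => le_max_right _ _
  have hn : ‖soft x s‖ ≠ 0 := by simpa using h0
  refine ⟨hfin.toFinset, ?_, ?_, ?_, ?_⟩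
  · obtain ⟨t, ht, hts⟩ := exists_lt_of_csInf_lt (adm_nonempty L x) hs
    refine ht.2 _ ?_ fun v hv => ?_
    · by_contra h
      rw [Finset.not_nonempty_iff_eq_empty] at h
      apply h0
      apply lp.ext
      funext v
      by_contra h'
      have := hsup v h'
      simp [h] at this
    · simp only [Finite.mem_toFinset, mem_ofPred_eq] at hv
      linarith
  · intro v hv
    apply hsup
    intro h
    apply hv
    simp [h]
  · intro v
    simp only [lp.coeFn_smul, Pi.smul_apply, smul_eq_mul]
    exact mul_nonneg (by positivity) (hpos v)
  · simp only [lp.coeFn_smul, Pi.smul_apply, smul_eq_mul]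
    rw [← Finset.mul_sum, ← norm_of_support hsup hpos, inv_mul_cancel₀ hn]

/-- `L` is a neighborhood retract around each nonempty closed subset of the Banach space. -/
theorem exists_retr (L : SimpComplex V) {K : Set (E V)} (hK : IsClosed K) (hne : K.Nonempty)
    (hKL : K ⊆ L.space) : ∃ W : Set (E V), IsOpen W ∧ K ⊆ W ∧ ∃ r : E V → E V,
      ContinuousOn r W ∧ MapsTo r W L.space ∧ ∀ x ∈ K, r x = x := by
  let ρ : E V → E V := fun x => soft x (thr L x + Metric.infDist x K)
  have hρ : Continuous ρ := by
    have h1 := continuous_thr L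
    have h2 := Metric.continuous_infDist_pt K
    exact continuous_soft.comp (continuous_id.prodMk (h1.add h2))
  have hρK : ∀ x ∈ K, ρ x = x := by
    intro x hx
    simp only [ρ]
    rw [thr_eq_zero L (hKL hx), Metric.infDist_zero_of_mem hx, add_zero, soft_thr_mem L (hKL hx)]
  have hrK : ∀ x ∈ K, ‖ρ x‖⁻¹ • ρ x = x := by
    intro x hx
    rw [hρK x hx, norm_mem L (hKL hx)]
    simp
  refine ⟨{x | ρ x ≠ 0}, isOpen_ne_fun hρ continuous_const, ?_, fun x => ‖ρ x‖⁻¹ • ρ x, ?_, ?_, hrK⟩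
  · intro x hx
    simp only [mem_ofPred_eq]
    rw [hρK x hx, ← norm_ne_zero_iff, norm_mem L (hKL hx)]
    exact one_ne_zero
  · refine ContinuousOn.smul (ContinuousOn.inv₀ hρ.norm.continuousOn ?_) hρ.continuousOn
    intro x hx
    simpa using hx
  · intro x hx
    by_cases hxK : x ∈ K
    · simp only
      rw [hrK x hxK]
      exact hKL hxK
    · have := (hK.notMem_iff_infDist_pos hne).1 hxK
      exact normalized_mem L (by linarith) hx

open Classical in
/-- truncation to finitely many coordinates -/
noncomputable def trunc (s : Finset V) (x : E V) : E V :=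
  ∑ i ∈ s, lp.single 1 i (x i)

theorem norm_sub_trunc (s : Finset V) (x : E V) :
    ‖x - trunc s x‖ = ‖x‖ - ∑ i ∈ s, |x i| := by
  classical
  have := lp.norm_sub_norm_compl_sub_single (p := 1) (by simp) x s
  simp only [ENNReal.toReal_one, Real.rpow_one, Real.norm_eq_abs] at this
  rw [← this, trunc, sub_sub_cancel]

theorem norm_trunc_le (s : Finset V) (x : E V) : ‖trunc s x‖ ≤ ‖x‖ := by
  classical
  have h := lp.norm_sum_single (p := 1) (E := fun _ : V => ℝ) (by simp) x s
  simp only [ENNReal.toReal_one, Real.rpow_one, Real.norm_eq_abs] at h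
  have h2 : ‖trunc s x‖ = ∑ i ∈ s, |x i| := by
    rw [← h, trunc]
  have := norm_sub_trunc s x
  have := norm_nonneg (x - trunc s x)
  linarith

theorem continuous_coord (v : V) : Continuous fun x : E V => x v :=
  (lp.evalCLM ℝ (fun _ : V => ℝ) 1 v).continuous

theorem continuous_trunc (s : Finset V) : Continuous (trunc s : E V → E V) := by
  classical
  unfold trunc
  exact continuous_finsetSum _ fun i _ =>
    (lp.isometry_single i).continuous.comp (continuous_coord i)

theorem unif_trunc {K : Set (E V)} (hK : IsCompact K) {ε : ℝ} (hε : 0 < ε) :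
    ∃ s : Finset V, ∀ x ∈ K, ‖x - trunc s x‖ < ε := by
  refine hK.elim_directed_cover (fun s : Finset V => {x | ‖x - trunc s x‖ < ε}) ?_ ?_ ?_
  · intro s
    exact isOpen_lt (continuous_id.sub (continuous_trunc s)).norm continuous_const
  · intro x _
    rw [mem_iUnion]
    have h : HasSum (fun v => |x v|) ‖x‖ := by
      rw [norm_eq]; exact (summable_abs x).hasSum
    obtain ⟨s, hs⟩ := (h.eventually (lt_mem_nhds (sub_lt_self ‖x‖ hε))).exists
    refine ⟨s, ?_⟩
    rw [mem_ofPred_eq, norm_sub_trunc]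
    linarith
  · refine directed_of_isDirected_le fun s t hst x hx => ?_
    rw [mem_ofPred_eq, norm_sub_trunc] at hx ⊢
    have := Finset.sum_le_sum_of_subset_of_nonneg hst (f := fun i => |x i|)
      (fun i _ _ => abs_nonneg _)
    linarith

variable {X : Type u} [TopologicalSpace X]

theorem tietze_step [NormalSpace X] {Y : Set X} (hY : IsClosed Y) (h : C(Y, E V))
    (hc : IsCompact (range h)) {r : ℝ} (hr : 0 < r) (hb : ∀ y, ‖h y‖ ≤ r) :
    ∃ g : C(X, E V), (∀ x, ‖g x‖ ≤ r) ∧ ∀ y : Y, ‖h y - g y‖ ≤ r / 2 := by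
  classical
  obtain ⟨s, hs⟩ := unif_trunc hc (half_pos hr)
  have h1 : ∀ v : V, ∃ g : C(X, ℝ), ∀ y : Y, g y = h y v := by
    intro v
    obtain ⟨g, hg⟩ := ContinuousMap.exists_restrict_eq hY
      (⟨fun y => h y v, (continuous_coord v).comp h.continuous⟩ : C(Y, ℝ))
    exact ⟨g, fun y => congrArg (fun k : C(Y, ℝ) => k y) hg⟩
  choose G hG using h1
  let T : X → E V := fun x => ∑ i ∈ s, lp.single 1 i (G i x)
  have hT : Continuous T := continuous_finsetSum _ fun i _ =>
    (lp.isometry_single i).continuous.comp (G i).continuous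
  have hTY : ∀ y : Y, T y = trunc s (h y) := by
    intro y
    simp only [T, trunc, hG]
  have hpos : ∀ x, 0 < max r ‖T x‖ := fun x => lt_max_of_lt_left hr
  refine ⟨⟨fun x => (r / max r ‖T x‖) • T x, ?_⟩, ?_, ?_⟩
  · refine Continuous.smul (Continuous.div continuous_const (continuous_const.max hT.norm)
      fun x => (hpos x).ne') hT
  · intro x
    simp only [ContinuousMap.coe_mk]
    rw [norm_smul, Real.norm_eq_abs, abs_of_nonneg (div_nonneg hr.le (hpos x).le), div_mul_eq_mul_div,
      div_le_iff₀ (hpos x)]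
    exact mul_le_mul_of_nonneg_left (le_max_right _ _) hr.le
  · intro y
    simp only [ContinuousMap.coe_mk]
    rw [hTY, max_eq_left ((norm_trunc_le s (h y)).trans (hb y)), div_self hr.ne', one_smul]
    exact (hs _ (mem_range_self y)).le

theorem isCompact_range_of_cc {Y : Type*} [TopologicalSpace Y] [CountablyCompactSpace Y]
    (h : C(Y, E V)) : IsCompact (range h) := by
  rw [← image_univ]
  exact ((CountablyCompactSpace.isCountablyCompact_univ).image h.continuous).isSeqCompact.isCompact

theorem tietze [NormalSpace X] {Y : Set X} (hY : IsClosed Y) [CountablyCompactSpace Y]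
    (f : C(Y, E V)) : ∃ F : C(X, E V), ∀ y : Y, F y = f y := by
  obtain ⟨C, hC0, hC⟩ : ∃ C : ℝ, 0 < C ∧ ∀ y, ‖f y‖ ≤ C := by
    obtain ⟨C, hC0, hC⟩ := (isCompact_range_of_cc f).isBounded.exists_pos_norm_le
    exact ⟨C, hC0, fun y => hC _ (mem_range_self y)⟩
  have step : ∀ (n : ℕ) (h : {h : C(Y, E V) // ∀ y, ‖h y‖ ≤ C / 2 ^ n}),
      ∃ g : C(X, E V), (∀ x, ‖g x‖ ≤ C / 2 ^ n) ∧ ∀ y : Y, ‖h.1 y - g y‖ ≤ C / 2 ^ (n + 1) := by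
    intro n h
    obtain ⟨g, h1, h2⟩ := tietze_step hY h.1 (isCompact_range_of_cc h.1)
      (show 0 < C / 2 ^ n by positivity) h.2
    exact ⟨g, h1, fun y => (h2 y).trans (by rw [pow_succ, div_div])⟩
  choose g hg1 hg2 using step
  let H : ∀ n : ℕ, {h : C(Y, E V) // ∀ y, ‖h y‖ ≤ C / 2 ^ n} := fun n =>
    Nat.rec ⟨f, by simpa using hC⟩
      (fun n h => ⟨h.1 - (g n h).restrict Y, fun y => hg2 n h y⟩) n
  have hH0 : (H 0).1 = f := rfl
  have hHs : ∀ n y, (H (n + 1)).1 y = (H n).1 y - g n (H n) y := fun n y => rfl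
  have hsum : ∀ (y : Y) (n : ℕ), ∑ k ∈ Finset.range n, g k (H k) y = f y - (H n).1 y := by
    intro y n
    induction n with
    | zero => simp [hH0]
    | succ n ih => rw [Finset.sum_range_succ, ih, hHs]; abel
  have hgeo : Summable fun n : ℕ => C / 2 ^ n := by
    have := (summable_geometric_two).mul_left C
    refine this.congr fun n => ?_
    simp [div_eq_mul_inv]
  refine ⟨⟨fun x => ∑' n, g n (H n) x, continuous_tsum (fun n => (g n (H n)).continuous) hgeo
    fun n x => hg1 n (H n) x⟩, fun y => ?_⟩
  have hs : Summable fun n => g n (H n) (y : X) := .of_norm_bounded hgeo fun n => hg1 n (H n) y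
  have h1 := hs.hasSum.tendsto_sum_nat
  simp only [hsum] at h1
  have h2 : Tendsto (fun n => (H n).1 y) atTop (𝓝 0) :=
    squeeze_zero_norm (fun n => (H n).2 y) hgeo.tendsto_atTop_zero
  have h3 : Tendsto (fun n => f y - (H n).1 y) atTop (𝓝 (f y)) := by
    simpa using h2.const_sub (f y)
  exact tendsto_nhds_unique h1 h3

/-- neighborhood extension -/
theorem nbhd_ext [NormalSpace X] [CountablyCompactSpace X] (L : SimpComplex V) {B : Set X}
    (hB : IsClosed B) {F : X → E V} (hF : ContinuousOn F B) (hFL : MapsTo F B L.space) :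
    ∃ (B' : Set X) (G : X → E V), IsClosed B' ∧ B ⊆ interior B' ∧ ContinuousOn G B' ∧
      MapsTo G B' L.space ∧ EqOn F G B := by
  rcases B.eq_empty_or_nonempty with rfl | hne
  · exact ⟨∅, F, isClosed_empty, empty_subset _, hF, hFL, fun x hx => hx.elim⟩
  have : CountablyCompactSpace B :=
    isCountablyCompact_iff_countablyCompactSpace.1 hB.isCountablyCompact
  let f : C(B, E V) := ⟨B.domRestrict F, hF.domRestrict⟩
  have hK := isCompact_range_of_cc f
  have := hne.to_subtype
  obtain ⟨W, hW, hKW, r, hr, hrL, hrK⟩ := exists_retr L hK.isClosed (range_nonempty f)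
    (by rintro _ ⟨y, rfl⟩; exact hFL y.2)
  obtain ⟨Φ, hΦ⟩ := tietze hB f
  have hBU : B ⊆ Φ ⁻¹' W := by
    intro x hx
    rw [mem_preimage, hΦ ⟨x, hx⟩]
    exact hKW (mem_range_self _)
  obtain ⟨O, hO, hBO, hOW⟩ := normal_exists_closure_subset hB (hW.preimage Φ.continuous) hBU
  refine ⟨closure O, fun x => r (Φ x), isClosed_closure,
    hBO.trans (interior_maximal subset_closure hO), ?_, fun x hx => hrL (hOW hx), ?_⟩
  · exact hr.comp Φ.continuous.continuousOn hOW
  · intro x hx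
    simp only
    rw [hΦ ⟨x, hx⟩, hrK _ (mem_range_self _)]
    rfl

theorem ext_piece {S : Set (E V)} {A Y : Set X} (hAE : IsAE S A) (hY : IsClosed Y)
    {F : X → E V} (hF : ContinuousOn F Y) (hFS : MapsTo F Y S) :
    ∃ G : X → E V, ContinuousOn G A ∧ MapsTo G A S ∧ EqOn F G (Y ∩ A) := by
  classical
  obtain ⟨g, hg⟩ := hAE (Subtype.val ⁻¹' Y) (hY.preimage continuous_subtype_val)
    ⟨fun y => ⟨F y.1.1, hFS y.2⟩, Continuous.subtype_mk
      (hF.comp_continuous (continuous_subtype_val.comp continuous_subtype_val) fun y => y.2) _⟩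
  refine ⟨fun x => if h : x ∈ A then (g ⟨x, h⟩ : E V) else 0, ?_, ?_, ?_⟩
  · rw [continuousOn_iff_continuous_domRestrict]
    have : Continuous fun a : A => (g a : E V) := continuous_subtype_val.comp g.continuous
    convert this using 1
    funext a
    simp
  · intro x hx
    simp [hx]
  · intro x hx
    have := hg ⟨⟨x, hx.2⟩, hx.1⟩
    simp [hx.2, this]

theorem glue {S : Set (E V)} {A Y : Set X} (hAE : IsAE S A) (hA : IsClosed A) (hY : IsClosed Y)
    {F : X → E V} (hF : ContinuousOn F Y) (hFS : MapsTo F Y S) :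
    ∃ G : X → E V, ContinuousOn G (Y ∪ A) ∧ MapsTo G (Y ∪ A) S ∧ EqOn F G Y := by
  classical
  obtain ⟨G, hG, hGS, hFG⟩ := ext_piece hAE hY hF hFS
  have h1 : EqOn (Y.piecewise F G) F Y := Y.piecewise_eqOn F G
  have h2 : EqOn (Y.piecewise F G) G A := by
    intro x hx
    by_cases hxY : x ∈ Y
    · rw [h1 hxY, hFG ⟨hxY, hx⟩]
    · exact piecewise_eq_of_notMem _ _ _ hxY
  refine ⟨Y.piecewise F G, (hF.congr h1).union_of_isClosed (hG.congr h2) hY hA, ?_, h1.symm⟩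
  rintro x (hx | hx)
  · rw [h1 hx]; exact hFS hx
  · rw [h2 hx]; exact hGS hx

/-- partial maps with closed domain -/
structure PMap (X : Type u) [TopologicalSpace X] (S : Set (E V)) where
  dom : Set X
  map : X → E V
  closed : IsClosed dom
  cont : ContinuousOn map dom
  maps : MapsTo map dom S

theorem main [NormalSpace X] [CountablyCompactSpace X] (A : ℕ → Set X) (hA : ∀ i, IsClosed (A i))
    (hcov : ⋃ i, A i = univ) (L : SimpComplex V) (hAE : ∀ i, IsAE ↥L.space ↥(A i)) :
    IsAE ↥L.space X := by
  classical
  intro Y hY f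
  have step : ∀ (n : ℕ) (P : PMap X L.space), ∃ Q : PMap X L.space,
      P.dom ∪ A n ⊆ interior Q.dom ∧ EqOn P.map Q.map P.dom := by
    intro n P
    obtain ⟨G, h1, h2, h3⟩ := glue (hAE n) (hA n) P.closed P.cont P.maps
    obtain ⟨B, H, k1, k2, k3, k4, k5⟩ := nbhd_ext L (P.closed.union (hA n)) h1 h2
    exact ⟨⟨B, H, k1, k3, k4⟩, k2, h3.trans (k5.mono subset_union_left)⟩
  choose N hN1 hN2 using step
  let P0 : PMap X L.space := ⟨Y, fun x => if h : x ∈ Y then (f ⟨x, h⟩ : E V) else 0, hY, by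
      rw [continuousOn_iff_continuous_domRestrict]
      have : Continuous fun a : Y => (f a : E V) := continuous_subtype_val.comp f.continuous
      convert this using 1
      funext a
      simp, by
      intro x hx
      simp [hx]⟩
  let P : ℕ → PMap X L.space := fun n => Nat.rec P0 (fun n Q => N n Q) n
  have hP : ∀ n, P (n + 1) = N n (P n) := fun n => rfl
  have hdom : ∀ n, (P n).dom ∪ A n ⊆ interior (P (n + 1)).dom := fun n => hN1 n (P n)
  have hmono : Monotone fun n => (P n).dom := monotone_nat_of_le_succ fun n =>
    (subset_union_left.trans (hdom n)).trans interior_subset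
  have hext : ∀ m n, m ≤ n → EqOn (P m).map (P n).map (P m).dom := by
    intro m n hmn
    induction n, hmn using Nat.le_induction with
    | base => exact fun _ _ => rfl
    | succ n hmn ih => exact ih.trans ((hN2 n (P n)).mono (hmono hmn))
  have hex : ∀ x, ∃ n, x ∈ interior (P n).dom := by
    intro x
    have : x ∈ ⋃ i, A i := hcov ▸ mem_univ x
    obtain ⟨i, hi⟩ := mem_iUnion.1 this
    exact ⟨i + 1, hdom i (Or.inr hi)⟩
  choose k hk using hex
  have hkd : ∀ x, x ∈ (P (k x)).dom := fun x => interior_subset (hk x)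
  let g : X → E V := fun x => (P (k x)).map x
  have hg : ∀ n, EqOn g (P n).map (P n).dom := by
    intro n x hx
    rcases le_total (k x) n with h | h
    · exact hext _ _ h (hkd x)
    · exact (hext _ _ h hx).symm
  have hgc : Continuous g := by
    rw [continuous_iff_continuousAt]
    intro x
    have hn : (P (k x)).dom ∈ 𝓝 x := mem_interior_iff_mem_nhds.1 (hk x)
    exact ((P (k x)).cont.congr (hg _)).continuousAt hn
  refine ⟨⟨fun x => ⟨g x, (P (k x)).maps (hkd x)⟩, hgc.subtype_mk _⟩, fun y => ?_⟩
  apply Subtype.ext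
  have := hg 0 (show (y : X) ∈ (P 0).dom from y.2)
  simp only [ContinuousMap.coe_mk]
  rw [this]
  simp [P, P0]

end CST

/-- Countable sum theorem: if a normal countably compact space is a countable union of
closed sets on each of which a simplicial complex `L` is an absolute extensor, then `L`
is an absolute extensor of the whole space. -/
theorem isAE_of_countable_closed_cover (X : Type u) [TopologicalSpace X] [NormalSpace X]
    (hX : CountablyCompact X) (A : ℕ → Set X) (hA : ∀ i, IsClosed (A i))
    (hcov : ⋃ i, A i = univ) {V : Type v} (L : SimpComplex V)
    (hAE : ∀ i, IsAE ↥L.space ↥(A i)) :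
    IsAE ↥L.space X := by
  have : CountablyCompactSpace X := ⟨by
    rw [isCountablyCompact_iff_countable_open_cover]
    intro U hU hc
    obtain ⟨t, ht⟩ := hX U hU (univ_subset_iff.1 hc)
    exact ⟨t, ht.ge⟩⟩
  exact CST.main A hA hcov L hAE
end

section
/- For every normal space X and natural number n, the covering dimension of X is at most n if and only if the n-sphere Sⁿ is an absolute extensor of X. -/
open Set Topology

universe u v w

section helpers

lemma fo_isOpen {X : Type*} [TopologicalSpace X] {U : Set X} (h : FunctionallyOpen U) :
    IsOpen U := by
  obtain ⟨φ, rfl⟩ := h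
  exact isOpen_compl_singleton.preimage φ.continuous

lemma fo_of {X : Type*} [TopologicalSpace X] {U : Set X} (φ : X → ℝ) (hφ : Continuous φ)
    (h : ∀ x, x ∈ U ↔ φ x ≠ 0) : FunctionallyOpen U :=
  ⟨⟨φ, hφ⟩, by ext x; simp [h]⟩

lemma fo_nonneg {X : Type*} [TopologicalSpace X] {U : Set X} (h : FunctionallyOpen U) :
    ∃ φ : X → ℝ, Continuous φ ∧ (∀ x, 0 ≤ φ x) ∧ ∀ x, x ∈ U ↔ φ x ≠ 0 := by
  obtain ⟨φ, rfl⟩ := h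
  exact ⟨fun x => |φ x|, by fun_prop, fun x => abs_nonneg _, fun x => by simp⟩

lemma fo_inter {X : Type*} [TopologicalSpace X] {U V : Set X} (hU : FunctionallyOpen U)
    (hV : FunctionallyOpen V) : FunctionallyOpen (U ∩ V) := by
  obtain ⟨φ, h1, h2, h3⟩ := fo_nonneg hU
  obtain ⟨ψ, k1, k2, k3⟩ := fo_nonneg hV
  exact fo_of (fun x => φ x * ψ x) (by fun_prop) (fun x => by simp [h3, k3])

lemma fo_union {X : Type*} [TopologicalSpace X] {U V : Set X} (hU : FunctionallyOpen U)
    (hV : FunctionallyOpen V) : FunctionallyOpen (U ∪ V) := by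
  obtain ⟨φ, h1, h2, h3⟩ := fo_nonneg hU
  obtain ⟨ψ, k1, k2, k3⟩ := fo_nonneg hV
  refine fo_of (fun x => φ x + ψ x) (by fun_prop) (fun x => ?_)
  rw [mem_union, h3, k3, Ne, Ne, Ne, add_eq_zero_iff_of_nonneg (h2 x) (k2 x)]
  tauto

lemma fo_biUnion {X : Type*} [TopologicalSpace X] {ι : Type*} (U : ι → Set X)
    (hU : ∀ i, FunctionallyOpen (U i)) (s : Finset ι) : FunctionallyOpen (⋃ i ∈ s, U i) := by
  choose φ h1 h2 h3 using fun i => fo_nonneg (hU i)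
  refine fo_of (fun x => ∑ i ∈ s, φ i x) (by fun_prop) (fun x => ?_)
  rw [Ne, Finset.sum_eq_zero_iff_of_nonneg (fun i _ => h2 i x)]
  simp [h3]

/-- Partition of unity whose supports are the given functionally open sets. -/
lemma fo_partition {X : Type*} [TopologicalSpace X] {ι : Type*} [Fintype ι] (U : ι → Set X)
    (hU : ∀ i, FunctionallyOpen (U i)) (hc : ∀ x, ∃ i, x ∈ U i) :
    ∃ φ : ι → X → ℝ, (∀ i, Continuous (φ i)) ∧ (∀ i x, 0 ≤ φ i x) ∧
      (∀ i x, x ∈ U i ↔ φ i x ≠ 0) ∧ ∀ x, ∑ i, φ i x = 1 := by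
  choose φ h1 h2 h3 using fun i => fo_nonneg (hU i)
  have hpos : ∀ x, 0 < ∑ i, φ i x := by
    intro x
    obtain ⟨i, hi⟩ := hc x
    exact Finset.sum_pos' (fun i _ => h2 i x)
      ⟨i, Finset.mem_univ _, lt_of_le_of_ne (h2 i x) (Ne.symm ((h3 i x).1 hi))⟩
  refine ⟨fun i x => φ i x / ∑ j, φ j x, fun i => ?_, fun i x => ?_, fun i x => ?_, fun x => ?_⟩
  · exact (h1 i).div (by fun_prop) (fun x => (hpos x).ne')
  · exact div_nonneg (h2 i x) (hpos x).le
  · rw [h3]; simp [(hpos x).ne']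
  · rw [← Finset.sum_div, div_self (hpos x).ne']

/-- General position. -/
lemma general_position {E : Type*} [NormedAddCommGroup E] [NormedSpace ℝ E]
    [FiniteDimensional ℝ E] {ι : Type*} (c : ι → E) (n : ℕ)
    (hn : Module.finrank ℝ E = n + 1) {ε : ℝ} (hε : 0 < ε) (T : Finset ι) :
    ∃ p : ι → E, (∀ j, dist (p j) (c j) < ε) ∧
      ∀ s : Finset ι, s ⊆ T → s.card ≤ n + 1 → LinearIndepOn ℝ p (s : Set ι) := by
  classical
  induction T using Finset.induction_on with
  | empty =>
    refine ⟨c, by simp [hε], fun s hs _ => ?_⟩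
    rw [Finset.subset_empty.1 hs]
    simp
  | insert a T ha ih =>
    obtain ⟨p, hp, hs⟩ := ih
    let F : Finset (Finset ι) := T.powerset.filter (fun s => s.card ≤ n)
    have hdense : Dense (⋂ s ∈ F, ((Submodule.span ℝ (p '' (s : Set ι)) : Set E)ᶜ)) := by
      apply dense_biInter_of_isOpen
      · intro s _
        exact (Submodule.closed_of_finiteDimensional _).isOpen_compl
      · exact F.countable_toSet
      · intro s hsF
        have hcard : s.card ≤ n := (Finset.mem_filter.1 hsF).2
        rw [← interior_eq_empty_iff_dense_compl]
        by_contra hne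
        have htop := Submodule.eq_top_of_nonempty_interior' _ (Set.nonempty_iff_ne_empty.2 hne)
        have h1 : Module.finrank ℝ (Submodule.span ℝ (p '' (s : Set ι))) ≤ s.card := by
          rw [← Finset.coe_image]
          exact (finrank_span_finset_le_card _).trans Finset.card_image_le
        rw [htop, finrank_top] at h1
        omega
    obtain ⟨q, hq, hqd⟩ := hdense.exists_dist_lt (c a) hε
    have hupd : ∀ s : Finset ι, a ∉ s → Set.EqOn p (Function.update p a q) s := by
      intro s has j hj
      rw [Function.update_of_ne]
      rintro rfl
      exact has hj
    refine ⟨Function.update p a q, fun j => ?_, fun s hsT hcard => ?_⟩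
    · by_cases h : j = a
      · subst h; simpa [dist_comm] using hqd
      · simpa [h] using hp j
    · by_cases has : a ∈ s
      · have hsub : s.erase a ⊆ T := by
          intro j hj
          have := hsT (Finset.mem_of_mem_erase hj)
          exact (Finset.mem_insert.1 this).resolve_left (Finset.ne_of_mem_erase hj)
        have hc1 : (s.erase a).card ≤ n := by
          rw [Finset.card_erase_of_mem has]; omega
        rw [← Finset.insert_erase has, Finset.coe_insert]
        have hna : a ∉ s.erase a := Finset.notMem_erase a s
        rw [linearIndepOn_insert (by simpa using hna)]
        refine ⟨(linearIndepOn_congr (hupd _ hna)).1 (hs _ hsub (by omega)), ?_⟩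
        rw [← (hupd _ hna).image_eq, Function.update_self]
        have := Set.mem_iInter₂.1 hq (s.erase a) (by simp [F, hsub, hc1])
        exact this
      · have hsub : s ⊆ T := fun j hj =>
          (Finset.mem_insert.1 (hsT hj)).resolve_left (by rintro rfl; exact has hj)
        exact (linearIndepOn_congr (hupd _ has)).1 (hs _ hsub hcard)

/-- Approximation of a bounded map by a nowhere vanishing one. -/
lemma approx_nonvanishing {X : Type*} [TopologicalSpace X] {n : ℕ} (h : CovDimLE X n)
    (f : X → EuclideanSpace ℝ (Fin (n + 1))) (hf : Continuous f) (hb : ∀ x, ‖f x‖ ≤ 1) :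
    ∃ g : X → EuclideanSpace ℝ (Fin (n + 1)), Continuous g ∧ (∀ x, g x ≠ 0) ∧
      ∀ x, ‖g x - f x‖ < 1 := by
  classical
  have hε : (0 : ℝ) < 1 / 2 := by norm_num
  obtain ⟨t, -, htf, ht⟩ := (isCompact_closedBall
    (0 : EuclideanSpace ℝ (Fin (n + 1))) 1).finite_cover_balls hε
  obtain ⟨𝒱, hV, hVc, hVr, hVo⟩ := h (htf.toFinset.image (fun c => f ⁻¹' Metric.ball c (1 / 2)))
    (by
      intro U hU
      obtain ⟨c, -, rfl⟩ := Finset.mem_image.1 hU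
      refine fo_of (fun x => max (1 / 2 - dist (f x) c) 0) (by fun_prop) (fun x => ?_)
      rw [mem_preimage, Metric.mem_ball]
      constructor
      · intro hx
        exact (lt_max_of_lt_left (by linarith)).ne'
      · intro hx
        by_contra hlt
        exact hx (max_eq_right (by linarith)))
    (by
      rw [eq_univ_iff_forall]
      intro x
      obtain ⟨c, hc, hxc⟩ := mem_iUnion₂.1 (ht (mem_closedBall_zero_iff.2 (hb x)))
      exact ⟨_, Finset.mem_coe.2 (Finset.mem_image_of_mem _ (htf.mem_toFinset.2 hc)), hxc⟩)
  have hVr' : ∀ V : 𝒱, ∃ c, ∀ x ∈ (V : Set X), dist (f x) c < 1 / 2 := by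
    rintro ⟨V, hVV⟩
    obtain ⟨U, hU, hVU⟩ := hVr V hVV
    obtain ⟨c, -, rfl⟩ := Finset.mem_image.1 hU
    exact ⟨c, fun x hx => hVU hx⟩
  choose c hc using hVr'
  obtain ⟨φ, φc, φ0, φU, φ1⟩ := fo_partition (fun V : 𝒱 => (V : Set X)) (fun V => hV V V.2)
    (by
      intro x
      obtain ⟨V, hVV, hx⟩ := (eq_univ_iff_forall.1 hVc) x
      exact ⟨⟨V, hVV⟩, hx⟩)
  obtain ⟨p, hp, hpi⟩ := general_position c n (by simp) hε Finset.univ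
  have hpos : ∀ x, ∃ V, 0 < φ V x := by
    intro x
    by_contra! hcon
    have : ∑ V, φ V x = 0 := Finset.sum_eq_zero fun V _ => le_antisymm (hcon V) (φ0 V x)
    rw [φ1] at this
    exact one_ne_zero this
  refine ⟨fun x => ∑ V, φ V x • p V, by fun_prop, fun x hx => ?_, fun x => ?_⟩
  · let s : Finset 𝒱 := Finset.univ.filter (fun V => φ V x ≠ 0)
    have hs : s.card ≤ n + 1 := by
      by_contra! hcon
      have hW := hVo (s.map (Function.Embedding.subtype _)) (by
        intro V hV
        obtain ⟨V, -, rfl⟩ := Finset.mem_map.1 hV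
        exact V.2) (by rwa [Finset.card_map])
      have : x ∈ ⋂₀ ((s.map (Function.Embedding.subtype _) : Finset (Set X)) : Set (Set X)) := by
        intro V hV
        obtain ⟨V, hVs, rfl⟩ := Finset.mem_map.1 hV
        exact (φU V x).2 (Finset.mem_filter.1 hVs).2
      rw [hW] at this
      exact this
    obtain ⟨V, hVx⟩ := hpos x
    have hli := linearIndepOn_finset_iff.1 (hpi s (Finset.subset_univ _) hs) (fun V => φ V x) (by
      rw [← hx]
      apply Finset.sum_subset (Finset.subset_univ _)
      intro V _ hVs
      have : φ V x = 0 := by simpa [s] using hVs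
      simp [this])
    exact hVx.ne' (hli V (by simp [s, hVx.ne']))
  · have e1 : (∑ V, φ V x • p V) - f x = ∑ V, φ V x • (p V - f x) := by
      simp only [smul_sub, Finset.sum_sub_distrib]
      rw [← Finset.sum_smul, φ1, one_smul]
    have hle : ∀ V, φ V x ≠ 0 → ‖p V - f x‖ < 1 := by
      intro V hVx
      have h1 := hc V x ((φU V x).2 hVx)
      have h2 := hp V
      rw [← dist_eq_norm]
      have h3 := dist_triangle_right (p V) (f x) (c V)
      linarith
    rw [e1]
    calc ‖∑ V, φ V x • (p V - f x)‖ ≤ ∑ V, φ V x * ‖p V - f x‖ := by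
          refine (norm_sum_le _ _).trans (le_of_eq (Finset.sum_congr rfl fun V _ => ?_))
          rw [norm_smul, Real.norm_of_nonneg (φ0 V x)]
      _ < ∑ V, φ V x := by
          obtain ⟨V, hVx⟩ := hpos x
          refine Finset.sum_lt_sum (fun V _ => ?_) ⟨V, Finset.mem_univ _, ?_⟩
          · by_cases h0 : φ V x = 0
            · simp [h0]
            · exact mul_le_of_le_one_right (φ0 V x) (hle V h0).le
          · exact mul_lt_of_lt_one_right hVx (hle V hVx.ne')
      _ = 1 := φ1 x

lemma isAE_of_covDimLE {X : Type*} [TopologicalSpace X] [NormalSpace X] {n : ℕ}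
    (h : CovDimLE X n) : IsAE ↥(Metric.sphere (0 : EuclideanSpace ℝ (Fin (n + 1))) 1) X := by
  intro Y hY f
  obtain ⟨F₀, hF₀⟩ := ContinuousMap.exists_restrict_eq hY
    (⟨fun y => (f y : EuclideanSpace ℝ (Fin (n + 1))), by fun_prop⟩ :
      C(Y, EuclideanSpace ℝ (Fin (n + 1))))
  have hF₀' : ∀ y : Y, F₀ y = (f y : EuclideanSpace ℝ (Fin (n + 1))) :=
    fun y => DFunLike.congr_fun hF₀ y
  have hf1 : ∀ y : Y, ‖(f y : EuclideanSpace ℝ (Fin (n + 1)))‖ = 1 := fun y => by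
    simpa using (f y).2
  have hm : ∀ x, 0 < max 1 ‖F₀ x‖ := fun x => lt_max_of_lt_left one_pos
  let F : X → EuclideanSpace ℝ (Fin (n + 1)) := fun x => (max 1 ‖F₀ x‖)⁻¹ • F₀ x
  have hFc : Continuous F := by
    refine Continuous.smul (Continuous.inv₀ (by fun_prop) (fun x => (hm x).ne')) (by fun_prop)
  have hFY : ∀ y : Y, F y = (f y : EuclideanSpace ℝ (Fin (n + 1))) := by
    intro y
    simp [F, hF₀', hf1]
  have hFb : ∀ x, ‖F x‖ ≤ 1 := by
    intro x
    rw [norm_smul, norm_inv, Real.norm_of_nonneg (hm x).le, inv_mul_le_iff₀ (hm x), mul_one]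
    exact le_max_right _ _
  obtain ⟨g, gc, g0, gF⟩ := approx_nonvanishing h F hFc hFb
  let Z : Set X := {x | inner ℝ (F x) (g x) ≤ 0}
  have hZ : IsClosed Z := isClosed_le (by fun_prop) continuous_const
  have hd : Disjoint Z Y := by
    rw [Set.disjoint_left]
    intro x hxZ hxY
    have h1 : ‖F x‖ = 1 := by rw [hFY ⟨x, hxY⟩, hf1]
    have h2 : inner ℝ (F x) (g x) = 1 + inner ℝ (F x) (g x - F x) := by
      rw [inner_sub_right, real_inner_self_eq_norm_sq, h1]; ring
    have h3 := (abs_le.1 (abs_real_inner_le_norm (F x) (g x - F x))).1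
    rw [h1, one_mul] at h3
    have h4 := gF x
    have h5 : inner ℝ (F x) (g x) ≤ 0 := hxZ
    linarith
  obtain ⟨u, uZ, uY, uI⟩ := exists_continuous_zero_one_of_isClosed hZ hY hd
  let H : X → EuclideanSpace ℝ (Fin (n + 1)) := fun x => (1 - u x) • g x + u x • F x
  have hHc : Continuous H := by fun_prop
  have hH0 : ∀ x, H x ≠ 0 := by
    intro x hx
    by_cases hxZ : x ∈ Z
    · have : u x = 0 := uZ hxZ
      simp only [H, this] at hx
      simp [g0] at hx
    · have h1 : 0 < inner ℝ (F x) (g x) := not_le.1 hxZ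
      have h2 : inner ℝ (H x) (g x) = (1 - u x) * ‖g x‖ ^ 2 + u x * inner ℝ (F x) (g x) := by
        simp only [H]
        rw [inner_add_left, real_inner_smul_left, real_inner_smul_left,
          real_inner_self_eq_norm_sq]
      rw [hx, inner_zero_left] at h2
      have h3 : 0 < ‖g x‖ ^ 2 := by have := norm_pos_iff.2 (g0 x); positivity
      obtain ⟨u0, u1⟩ := uI x
      rcases eq_or_lt_of_le u0 with h0 | h0
      · rw [← h0] at h2; linarith
      · have := mul_pos h0 h1
        have := mul_nonneg (sub_nonneg.2 u1) h3.le
        linarith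
  refine ⟨⟨fun x => ⟨‖H x‖⁻¹ • H x, ?_⟩, ?_⟩, fun y => ?_⟩
  · simp [norm_smul, hH0]
  · exact Continuous.subtype_mk
      ((hHc.norm.inv₀ (fun x => norm_ne_zero_iff.2 (hH0 x))).smul hHc) _
  · have h1 : u y = 1 := uY y.2
    have h2 : H y = f y := by simp [H, h1, hFY]
    apply Subtype.ext
    change ‖H y‖⁻¹ • H y = _
    rw [h2, hf1, inv_one, one_smul]

lemma shrink_basic {X : Type*} [TopologicalSpace X] {n : ℕ}
    (h : IsAE ↥(Metric.sphere (0 : EuclideanSpace ℝ (Fin (n + 1))) 1) X)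
    (U : Fin (n + 2) → Set X) (hU : ∀ i, FunctionallyOpen (U i)) (hc : ∀ x, ∃ i, x ∈ U i) :
    ∃ V : Fin (n + 2) → Set X, (∀ i, FunctionallyOpen (V i)) ∧ (∀ i, V i ⊆ U i) ∧
      (∀ x, ∃ i, x ∈ V i) ∧ ∀ x, ∃ i, x ∉ V i := by
  obtain ⟨φ, φc, φ0, φU, φ1⟩ := fo_partition U hU hc
  let Y : Set X := ⋃ i, (U i)ᶜ
  have hY : IsClosed Y := isClosed_iUnion_of_finite fun i => (fo_isOpen (hU i)).isClosed_compl
  let f : X → EuclideanSpace ℝ (Fin (n + 1)) := fun x =>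
    WithLp.toLp 2 (fun i => φ i.castSucc x - φ (Fin.last _) x)
  have hfc : Continuous f := by
    refine (PiLp.continuous_toLp 2 _).comp (continuous_pi fun i => ?_)
    exact (φc _).sub (φc _)
  have hf0 : ∀ x ∈ Y, f x ≠ 0 := by
    intro x hx h0
    obtain ⟨i, hi⟩ := mem_iUnion.1 hx
    have hi0 : φ i x = 0 := by
      by_contra hne
      exact hi ((φU i x).2 hne)
    have hall : ∀ j, φ j x = φ (Fin.last _) x := by
      intro j
      refine Fin.lastCases rfl (fun j => ?_) j
      have := congrArg (fun v : EuclideanSpace ℝ (Fin (n + 1)) => v j) h0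
      simpa [f, sub_eq_zero] using this
    have h1 := φ1 x
    rw [Finset.sum_eq_zero] at h1
    · exact zero_ne_one h1
    · intro j _
      rw [hall j, ← hall i, hi0]
  have hfY : Continuous (fun y : Y => f y) := hfc.comp continuous_subtype_val
  have hsph : ∀ y : Y, ‖f y‖⁻¹ • f y ∈
      Metric.sphere (0 : EuclideanSpace ℝ (Fin (n + 1))) 1 := fun y => by
    simp [norm_smul, hf0 y y.2]
  have hcn : Continuous (fun y : Y => ‖f y‖⁻¹ • f y) :=
    (hfY.norm.inv₀ (fun y => norm_ne_zero_iff.2 (hf0 y y.2))).smul hfY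
  obtain ⟨g, hg⟩ := h Y hY ⟨fun y => ⟨‖f y‖⁻¹ • f y, hsph y⟩, hcn.subtype_mk hsph⟩
  let G : Fin (n + 2) → X → ℝ :=
    Fin.lastCases (fun _ => 0) (fun i x => (g x : EuclideanSpace ℝ (Fin (n + 1))) i)
  have hGl : ∀ x, G (Fin.last _) x = 0 := by intro x; simp [G]
  have hGc : ∀ i x, G (Fin.castSucc i) x = (g x : EuclideanSpace ℝ (Fin (n + 1))) i := by
    intro i x; simp [G]
  have hGcont : ∀ i, Continuous (G i) := by
    intro i
    refine Fin.lastCases ?_ (fun i => ?_) i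
    · simp only [G, Fin.lastCases_last]; exact continuous_const
    · simp only [G, Fin.lastCases_castSucc]; fun_prop
  let m : X → ℝ := fun x => Finset.univ.inf' Finset.univ_nonempty (fun i => G i x)
  have hmc : Continuous m := Continuous.finset_inf'_apply _ fun i _ => hGcont i
  have hmle : ∀ i x, m x ≤ G i x := fun i x => Finset.inf'_le _ (Finset.mem_univ i)
  have hmex : ∀ x, ∃ i, m x = G i x := fun x => by
    obtain ⟨i, -, hi⟩ := Finset.exists_mem_eq_inf' Finset.univ_nonempty (fun i => G i x)
    exact ⟨i, hi⟩
  refine ⟨fun i => {x | G i x - m x ≠ 0}, fun i => fo_of _ ((hGcont i).sub hmc) fun x => Iff.rfl,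
    fun i x hx => ?_, fun x => ?_, fun x => ?_⟩
  · by_contra hxU
    have hxY : x ∈ Y := mem_iUnion.2 ⟨i, hxU⟩
    have hgx : (g x : EuclideanSpace ℝ (Fin (n + 1))) = ‖f x‖⁻¹ • f x :=
      congrArg Subtype.val (hg ⟨x, hxY⟩)
    have hi0 : φ i x = 0 := by
      by_contra hne
      exact hxU ((φU i x).2 hne)
    have hGφ : ∀ j, G j x = ‖f x‖⁻¹ * (φ j x - φ (Fin.last _) x) := by
      intro j
      refine Fin.lastCases ?_ (fun j => ?_) j
      · rw [hGl]; simp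
      · rw [hGc, hgx]; simp [f]
    apply hx
    have : m x = G i x := by
      apply le_antisymm (hmle i x)
      obtain ⟨j, hj⟩ := hmex x
      rw [hj, hGφ, hGφ, hi0]
      have := φ0 j x
      gcongr
    rw [this, sub_self]
  · by_contra! hcon
    have hall : ∀ i, G i x = m x := fun i => by
      have := hcon i
      simpa [sub_eq_zero] using this
    have hz : ∀ i, G i x = 0 := fun i => by rw [hall, ← hall (Fin.last _), hGl]
    have hg0 : (g x : EuclideanSpace ℝ (Fin (n + 1))) = 0 := by
      ext i
      rw [← hGc, hz]; rfl
    have hg1 : ‖(g x : EuclideanSpace ℝ (Fin (n + 1)))‖ = 1 := by simpa using (g x).2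
    rw [hg0, norm_zero] at hg1
    exact zero_ne_one hg1
  · obtain ⟨i, hi⟩ := hmex x
    exact ⟨i, fun hx => hx (by rw [hi, sub_self])⟩

lemma shrink_step {X : Type*} [TopologicalSpace X] {n : ℕ}
    (h : IsAE ↥(Metric.sphere (0 : EuclideanSpace ℝ (Fin (n + 1))) 1) X)
    {ι : Type*} [Fintype ι]
    (U : ι → Set X) (hU : ∀ i, FunctionallyOpen (U i)) (hc : ∀ x, ∃ i, x ∈ U i)
    (s : Finset ι) (hs : s.card = n + 2) :
    ∃ V : ι → Set X, (∀ i, FunctionallyOpen (V i)) ∧ (∀ i, V i ⊆ U i) ∧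
      (∀ x, ∃ i, x ∈ V i) ∧ ∀ x, ∃ i ∈ s, x ∉ V i := by
  classical
  let e : s ≃ Fin (n + 2) := s.equivFinOfCardEq hs
  let A : Fin (n + 2) → Set X := fun k =>
    if k = 0 then U (e.symm 0) ∪ ⋃ j ∈ sᶜ, U j else U (e.symm k)
  obtain ⟨V, hV, hVA, hVc, hVe⟩ := shrink_basic h A
    (by
      intro k
      by_cases hk : k = 0
      · simp only [A, hk, if_true]
        exact fo_union (hU _) (fo_biUnion U hU _)
      · simp only [A, hk, if_false]
        exact hU _)
    (by
      intro x
      obtain ⟨i, hi⟩ := hc x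
      by_cases his : i ∈ s
      · refine ⟨e ⟨i, his⟩, ?_⟩
        by_cases hk : e ⟨i, his⟩ = 0
        · simp only [A, hk, if_true]
          left
          rw [← hk]; simpa using hi
        · simp only [A, hk, if_false]
          simpa using hi
      · refine ⟨0, ?_⟩
        simp only [A, if_true]
        right
        exact mem_iUnion₂.2 ⟨i, by simpa using his, hi⟩)
  refine ⟨fun j => (if hj : j ∈ s then V (e ⟨j, hj⟩) else V 0) ∩ U j, fun j => ?_,
    fun j => inter_subset_right, fun x => ?_, fun x => ?_⟩
  · refine fo_inter ?_ (hU j)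
    split_ifs <;> exact hV _
  · obtain ⟨k, hk⟩ := hVc x
    have hkA := hVA k hk
    by_cases hk0 : k = 0
    · subst hk0
      simp only [A, if_true] at hkA
      rcases hkA with hx | hx
      · exact ⟨e.symm 0, by simpa using hk, hx⟩
      · obtain ⟨j, hj, hx⟩ := mem_iUnion₂.1 hx
        have hj' : j ∉ s := by simpa using hj
        exact ⟨j, by simpa [hj'] using hk, hx⟩
    · simp only [A, hk0, if_false] at hkA
      exact ⟨e.symm k, by simpa using hk, hkA⟩
  · obtain ⟨k, hk⟩ := hVe x
    refine ⟨e.symm k, (e.symm k).2, fun hx => hk ?_⟩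
    simpa using hx.1

lemma shrink_all {X : Type*} [TopologicalSpace X] {n : ℕ}
    (h : IsAE ↥(Metric.sphere (0 : EuclideanSpace ℝ (Fin (n + 1))) 1) X)
    {ι : Type*} [Fintype ι]
    (U : ι → Set X) (hU : ∀ i, FunctionallyOpen (U i)) (hc : ∀ x, ∃ i, x ∈ U i)
    (S : Finset (Finset ι)) (hS : ∀ s ∈ S, s.card = n + 2) :
    ∃ V : ι → Set X, (∀ i, FunctionallyOpen (V i)) ∧ (∀ i, V i ⊆ U i) ∧
      (∀ x, ∃ i, x ∈ V i) ∧ ∀ s ∈ S, ∀ x, ∃ i ∈ s, x ∉ V i := by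
  classical
  induction S using Finset.induction_on with
  | empty => exact ⟨U, hU, fun i => Subset.rfl, hc, by simp⟩
  | insert s S hs ih =>
    obtain ⟨V, h1, h2, h3, h4⟩ := ih fun t ht => hS t (Finset.mem_insert_of_mem ht)
    obtain ⟨W, k1, k2, k3, k4⟩ := shrink_step h V h1 h3 s (hS s (Finset.mem_insert_self _ _))
    refine ⟨W, k1, fun i => (k2 i).trans (h2 i), k3, fun t ht x => ?_⟩
    rcases Finset.mem_insert.1 ht with rfl | ht
    · exact k4 x
    · obtain ⟨i, hi, hx⟩ := h4 t ht x
      exact ⟨i, hi, fun hxW => hx (k2 i hxW)⟩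

lemma covDimLE_of_isAE {X : Type*} [TopologicalSpace X] {n : ℕ}
    (h : IsAE ↥(Metric.sphere (0 : EuclideanSpace ℝ (Fin (n + 1))) 1) X) : CovDimLE X n := by
  classical
  intro 𝒰 hU hUc
  obtain ⟨V, h1, h2, h3, h4⟩ := shrink_all h (fun U : 𝒰 => (U : Set X)) (fun U => hU U U.2)
    (by
      intro x
      obtain ⟨V, hVV, hx⟩ := (eq_univ_iff_forall.1 hUc) x
      exact ⟨⟨V, hVV⟩, hx⟩)
    (Finset.powersetCard (n + 2) Finset.univ) (fun s hs => (Finset.mem_powersetCard.1 hs).2)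
  refine ⟨Finset.univ.image V, ?_, ?_, ?_, ?_⟩
  · intro W hW
    obtain ⟨i, -, rfl⟩ := Finset.mem_image.1 hW
    exact h1 i
  · rw [eq_univ_iff_forall]
    intro x
    obtain ⟨i, hi⟩ := h3 x
    exact ⟨V i, by simp, hi⟩
  · intro W hW
    obtain ⟨i, -, rfl⟩ := Finset.mem_image.1 hW
    exact ⟨i, i.2, h2 i⟩
  · intro 𝒲 hW hcard
    obtain ⟨𝒲', hW', hcard'⟩ := Finset.exists_subset_card_eq (show n + 2 ≤ 𝒲.card from hcard)
    have hex : ∀ W : 𝒲', ∃ i, V i = W := fun W => by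
      obtain ⟨i, -, hi⟩ := Finset.mem_image.1 (hW (hW' W.2))
      exact ⟨i, hi⟩
    choose r hr using hex
    have hinj : Function.Injective r := by
      intro a b hab
      apply Subtype.ext
      rw [← hr a, ← hr b, hab]
    rw [eq_empty_iff_forall_notMem]
    intro x hx
    obtain ⟨i, hi, hxi⟩ := h4 (Finset.univ.image r) (by
      rw [Finset.mem_powersetCard]
      refine ⟨Finset.subset_univ _, ?_⟩
      rw [Finset.card_image_of_injective _ hinj]
      simpa using hcard') x
    obtain ⟨W, -, rfl⟩ := Finset.mem_image.1 hi
    apply hxi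
    rw [hr]
    exact hx W (hW' W.2)

lemma covDim_le_iff {X : Type*} [TopologicalSpace X] (n : ℕ) :
    covDim X ≤ (n : ℕ∞) ↔ CovDimLE X n := by
  constructor
  · intro h
    have hlt : covDim X < ((n + 1 : ℕ) : ℕ∞) :=
      lt_of_le_of_lt h (by exact_mod_cast Nat.lt_succ_self n)
    obtain ⟨_, ⟨m, hm, rfl⟩, hmn⟩ := sInf_lt_iff.1 hlt
    have hmn' : m < n + 1 := by exact_mod_cast hmn
    intro 𝒰 hU hUc
    obtain ⟨𝒱, h1, h2, h3, h4⟩ := hm 𝒰 hU hUc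
    exact ⟨𝒱, h1, h2, h3, fun 𝒲 hW hc => h4 𝒲 hW (by omega)⟩
  · intro h
    exact sInf_le ⟨n, h, rfl⟩

end helpers

/-- Alexandroff's characterization: for a normal space `X`, `dim X ≤ n` iff the `n`-sphere
is an absolute extensor of `X`. -/
theorem covDim_le_iff_sphere_isAE (X : Type u) [TopologicalSpace X] [NormalSpace X]
    (n : ℕ) :
    covDim X ≤ (n : ℕ∞) ↔
      IsAE ↥(Metric.sphere (0 : EuclideanSpace ℝ (Fin (n + 1))) 1) X := by
  rw [covDim_le_iff]
  exact ⟨isAE_of_covDimLE, covDimLE_of_isAE⟩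
end
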